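/- arXiv:1709.04645 — 2 statements merged into one kernel-verified Lean document; each statement's English description precedes it below -/
import Mathlib

section
/- Let (G,X) be a 3-connected constraint graph such that X is disconnected in G. Assume that every edge not in X is essential and that (G,X) is neither the constraint wheel nor the weird prism. Then G[X] has precisely two connected components, and every edge of G not in X has both its endvertices in V(X), the set of endvertices of edges of X. -/
open SimpleGraph

/-- An edge set `X` is connected: any two vertices covered by `X` are joined by a path
consisting of edges of `X`.  (The empty edge set counts as connected.) -/
def EdgeSetConnected {V : Type*} (X : Set (Sym2 V)) : Prop :=
  ∀ u ∈ (fromEdgeSet X).support, ∀ v ∈ (fromEdgeSet X).support, (fromEdgeSet X).Reachable u v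

/-- The subgraph `G[X]` spanned by an edge set `X`, as a graph on the covered vertices. -/
def edgeSubgraph {V : Type*} (X : Set (Sym2 V)) :
    SimpleGraph ((fromEdgeSet X).support) :=
  (fromEdgeSet X).induce (fromEdgeSet X).support

/-- The number of connected components of `G[X]`. -/
noncomputable def edgeComponents {V : Type*} (X : Set (Sym2 V)) : ℕ :=
  Nat.card (edgeSubgraph X).ConnectedComponent

/-- A graph is `k`-connected if it has more than `k` vertices and deleting fewer than `k`
vertices always leaves a connected graph. -/
def KConnected {V : Type*} (k : ℕ) (G : SimpleGraph V) : Prop :=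
  k < Nat.card V ∧ ∀ S : Set V, S.ncard < k → (G.induce Sᶜ).Connected

/-- A constraint graph: a finite simple graph `G` together with a set `X` of edges. -/
structure CGraph : Type 1 where
  V : Type
  G : SimpleGraph V
  X : Set (Sym2 V)
  fin : Finite V := by infer_instance

attribute [instance] CGraph.fin

/-- `X` really is a set of edges of `G`. -/
def CGraph.WF (C : CGraph) : Prop := C.X ⊆ C.G.edgeSet

/-- The vertex map contracting `v` onto `u`. -/
noncomputable def contractFun {V : Type*} {u v : V} (huv : u ≠ v) (x : V) : {w : V // w ≠ v} :=
  letI := Classical.decEq V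
  if h : x = v then ⟨u, huv⟩ else ⟨x, h⟩

/-- Contraction of a simple graph, identifying `v` with `u` (loops are discarded, parallel
edges are merged, so the result is simple). -/
noncomputable def contractGraph {V : Type*} (G : SimpleGraph V) {u v : V} (huv : u ≠ v) :
    SimpleGraph {w : V // w ≠ v} :=
  fromEdgeSet (Sym2.map (contractFun huv) '' G.edgeSet)

/-- Contraction of a constraint graph: identify `v` with `u`; the new constraint consists of all
non-loop images of constraint edges; thus in each parallel class edges of `X` are preferred. -/
noncomputable def CGraph.contract (C : CGraph) (u v : C.V) (huv : u ≠ v) : CGraph where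
  V := {w : C.V // w ≠ v}
  G := contractGraph C.G huv
  X := {e | e ∈ Sym2.map (contractFun huv) '' C.X ∧ ¬ e.IsDiag}

/-- Deletion of an edge from a constraint graph. -/
def CGraph.deleteEdge (C : CGraph) (e : Sym2 C.V) : CGraph where
  V := C.V
  G := C.G.deleteEdges {e}
  X := C.X

/-- One step in forming a constraint minor: delete an edge not in `X`, or contract an edge. -/
inductive CMinorStep : CGraph → CGraph → Prop
  | del (C : CGraph) (e : Sym2 C.V) (he : e ∈ C.G.edgeSet) (hx : e ∉ C.X) :
      CMinorStep C (C.deleteEdge e)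
  | contr (C : CGraph) (u v : C.V) (h : C.G.Adj u v) :
      CMinorStep C (C.contract u v h.ne)

/-- The constraint-minor relation. -/
def IsCMinor : CGraph → CGraph → Prop := Relation.ReflTransGen CMinorStep

/-- Isomorphism of constraint graphs. -/
def CGIso (C D : CGraph) : Prop :=
  ∃ φ : C.G ≃g D.G, Sym2.map (⇑φ) '' C.X = D.X

/-- The constraint `K₄`. -/
def constraintK4 : CGraph where
  V := Fin 4
  G := ⊤
  X := {s(0, 1), s(2, 3)}

def wheelGraph : SimpleGraph (Fin 5) :=
  fromEdgeSet {s(0, 1), s(1, 2), s(2, 3), s(3, 0), s(0, 4), s(1, 4), s(2, 4), s(3, 4)}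

/-- The constraint wheel. -/
def constraintWheel : CGraph where
  V := Fin 5
  G := wheelGraph
  X := {s(0, 1), s(2, 3)}

/-- The prism `K₃ □ K₂`, with triangles `{0,1,2}` and `{3,4,5}`. -/
def prismGraph : SimpleGraph (Fin 6) :=
  fromEdgeSet {s(0, 1), s(1, 2), s(0, 2), s(3, 4), s(4, 5), s(3, 5), s(0, 3), s(1, 4), s(2, 5)}

def topEdges : Set (Sym2 (Fin 6)) := {s(0, 1), s(1, 2), s(0, 2)}
def botEdges : Set (Sym2 (Fin 6)) := {s(3, 4), s(4, 5), s(3, 5)}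

/-- Constraint sets of the four constraint prisms: contained in the two triangles and meeting
every vertex, inducing a spanning connected subgraph of each triangle. -/
def PrismConstraintSet (X : Set (Sym2 (Fin 6))) : Prop :=
  X ⊆ topEdges ∪ botEdges ∧
  EdgeSetConnected (X ∩ topEdges) ∧ (fromEdgeSet (X ∩ topEdges)).support = {0, 1, 2} ∧
  EdgeSetConnected (X ∩ botEdges) ∧ (fromEdgeSet (X ∩ botEdges)).support = {3, 4, 5}

/-- `C` is one of the four constraint prisms. -/
def IsConstraintPrism (C : CGraph) : Prop :=
  ∃ X, PrismConstraintSet X ∧ CGIso C (CGraph.mk (Fin 6) prismGraph X)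

/-- The six obstructions. -/
def IsObstruction (D : CGraph) : Prop :=
  CGIso D constraintK4 ∨ CGIso D constraintWheel ∨ IsConstraintPrism D

/-- The weird prism. -/
def weirdPrism : CGraph where
  V := Fin 6
  G := prismGraph
  X := {s(0, 3), s(1, 4), s(2, 5)}

/-- The Wagner graph `V₈`. -/
def wagnerGraph : SimpleGraph (Fin 8) :=
  fromEdgeSet {s(0, 1), s(1, 2), s(2, 3), s(3, 4), s(4, 5), s(5, 6), s(6, 7), s(7, 0),
    s(0, 4), s(1, 5), s(2, 6), s(3, 7)}

/-- The constraint Wagner graph: `X` is the complement of the 6-cycle `0-1-5-4-3-7-0`. -/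
def constraintWagner : CGraph where
  V := Fin 8
  G := wagnerGraph
  X := {s(1, 2), s(2, 3), s(5, 6), s(6, 7), s(0, 4), s(2, 6)}

/-- The Wagner prism. -/
def wagnerPrism : CGraph where
  V := Fin 6
  G := prismGraph
  X := {s(0, 3), s(1, 2), s(4, 5)}

/-- `(G, X)` has a 3-connected constraint minor whose constraint is disconnected. -/
def BadMinor (C : CGraph) : Prop :=
  ∃ C', IsCMinor C C' ∧ KConnected 3 C'.G ∧ ¬ EdgeSetConnected C'.X

/-- An edge `e ∉ X` is essential if neither `(G/e, X ∩ E(G/e))` nor `(G∖e, X)` has a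
3-connected constraint minor with disconnected constraint. -/
def Essential (C : CGraph) (e : Sym2 C.V) : Prop :=
  ¬ BadMinor (C.deleteEdge e) ∧
  ∀ u v, ∀ h : C.G.Adj u v, s(u, v) = e → ¬ BadMinor (C.contract u v h.ne)

/-- An edge joining two distinct components of `G[X]`. -/
def JoinsComponents {V : Type*} (X : Set (Sym2 V)) (e : Sym2 V) : Prop :=
  ∃ a b, e = s(a, b) ∧ a ∈ (fromEdgeSet X).support ∧ b ∈ (fromEdgeSet X).support ∧
    ¬ (fromEdgeSet X).Reachable a b

/-- The degree of a vertex. -/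
noncomputable def vdeg {V : Type*} (G : SimpleGraph V) (v : V) : ℕ := (G.neighborSet v).ncard

/-- The component of `G[X]` containing the edge `f` consists of the single edge `f`. -/
def SingleEdgeComponent {V : Type*} (X : Set (Sym2 V)) (f : Sym2 V) : Prop :=
  f ∈ X ∧ ∀ g ∈ X, (∃ a ∈ f, ∃ b ∈ g, (fromEdgeSet X).Reachable a b) → g = f

/-- The edges of `Q` with all endvertices in `S`: the edges of the side `Q[S]`. -/
def sideEdges {V : Type*} (Q : SimpleGraph V) (S : Set V) : Set (Sym2 V) :=
  {e | e ∈ Q.edgeSet ∧ ∀ v ∈ e, v ∈ S}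

/-- The edges of `Q` with one endvertex in `S` and one outside `S`. -/
def crossEdges {V : Type*} (Q : SimpleGraph V) (S : Set V) : Set (Sym2 V) :=
  {e | e ∈ Q.edgeSet ∧ (∃ v ∈ e, v ∈ S) ∧ ∃ v ∈ e, v ∉ S}

/-- `d` is a bond of `Q` with sides induced by `S` and `Sᶜ`. -/
def IsBondWith {V : Type*} (Q : SimpleGraph V) (d : Set (Sym2 V)) (S : Set V) : Prop :=
  S.Nonempty ∧ Sᶜ.Nonempty ∧ (Q.induce S).Connected ∧ (Q.induce Sᶜ).Connected ∧
    d = crossEdges Q S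

/-- `Q` is 3-connected along the bond `d` (with left side `S`): `Q` is 2-connected and no pair
of vertices, one from each side, separates `Q`. -/
def ThreeConnAlong {V : Type*} (Q : SimpleGraph V) (d : Set (Sym2 V)) (S : Set V) : Prop :=
  IsBondWith Q d S ∧ KConnected 2 Q ∧
    ∀ x ∈ S, ∀ y ∈ Sᶜ, (Q.induce ({x, y}ᶜ : Set V)).Preconnected

/-- One step of a special contraction minor: contract an edge not in the bond. -/
inductive SCMStep : CGraph → CGraph → Prop
  | contr (C : CGraph) (u v : C.V) (h : C.G.Adj u v) (hd : s(u, v) ∉ C.X) :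
      SCMStep C (C.contract u v h.ne)

/-- The special-contraction-minor relation. -/
def IsSCMinor : CGraph → CGraph → Prop := Relation.ReflTransGen SCMStep

/-- A proper (non-identical) special contraction minor. -/
def IsProperSCMinor : CGraph → CGraph → Prop := Relation.TransGen SCMStep

/-- The special `K₄`: `K₄` together with a bond of size 4. -/
def specialK4 : CGraph where
  V := Fin 4
  G := ⊤
  X := {s(0, 2), s(0, 3), s(1, 2), s(1, 3)}

/-- The special prism: the prism together with the bond complementing the two triangles. -/
def specialPrism : CGraph where
  V := Fin 6
  G := prismGraph
  X := {s(0, 3), s(1, 4), s(2, 5)}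

/-- `(Q, d)` is 3-connected along `d` and both sides of `d` contain edges. -/
def GoodAlong (C : CGraph) : Prop :=
  ∃ S : Set C.V, ThreeConnAlong C.G C.X S ∧
    (sideEdges C.G S).Nonempty ∧ (sideEdges C.G Sᶜ).Nonempty

/-- `(Q, d)` is irreducible. -/
def BondIrreducible (C : CGraph) : Prop :=
  (∃ S : Set C.V, ThreeConnAlong C.G C.X S) ∧
  ¬ ∃ C', IsProperSCMinor C C' ∧ GoodAlong C'

/-- An edge set forming a triangle. -/
def IsTriangle {V : Type*} (X : Set (Sym2 V)) : Prop :=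
  ∃ a b c : V, a ≠ b ∧ a ≠ c ∧ b ≠ c ∧ X = {s(a, b), s(b, c), s(a, c)}

/-- An edge set consisting of a single edge. -/
def IsSingleEdge {V : Type*} (X : Set (Sym2 V)) : Prop :=
  ∃ a b : V, a ≠ b ∧ X = {s(a, b)}

/-- `M` is (isomorphic to) the cycle matroid of `G`, via the bijection `f` between the ground
set of `M` and the edges of `G`: a set is independent iff its image is a forest. -/
def IsGraphicRep {α : Type} (M : Matroid α) {V : Type} (G : SimpleGraph V)
    (f : α → Sym2 V) : Prop :=
  Set.BijOn f M.E G.edgeSet ∧ ∀ I ⊆ M.E, (M.Indep I ↔ (fromEdgeSet (f '' I)).IsAcyclic)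

/-- The constraint matroid `(M, X)` is realisable. -/
def Realisable {α : Type} (M : Matroid α) (X : Set α) : Prop :=
  ∃ (V : Type) (_ : Finite V) (G : SimpleGraph V) (f : α → Sym2 V),
    IsGraphicRep M G f ∧ EdgeSetConnected (f '' X)

/-- Deletion of a set of elements from a matroid. -/
def Matroid.del {α : Type} (M : Matroid α) (D : Set α) : Matroid α := Matroid.restrict M (M.E \ D)

/-- Contraction of a set of elements of a matroid. -/
def Matroid.con {α : Type} (M : Matroid α) (C : Set α) : Matroid α :=
  Matroid.dual (Matroid.del (Matroid.dual M) C)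

/-- `(N, Y)` is a constraint minor of `(M, X)`: contract an arbitrary set `C` and delete a
set `D` of elements not in `X`. -/
def MatroidCMinor {α : Type} (M : Matroid α) (X : Set α) (N : Matroid α) (Y : Set α) : Prop :=
  ∃ C D : Set α, D ⊆ M.E \ X ∧ N = (M.con C).del D ∧ Y = X \ C

/-- `(N, Y)` is isomorphic, via the cycle matroid, to one of the six obstructions. -/
def MatroidObstruction {α : Type} (N : Matroid α) (Y : Set α) : Prop :=
  (∃ f : α → Sym2 (Fin 4), IsGraphicRep N constraintK4.G f ∧ f '' Y = constraintK4.X) ∨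
  (∃ f : α → Sym2 (Fin 5), IsGraphicRep N constraintWheel.G f ∧ f '' Y = constraintWheel.X) ∨
  (∃ X, PrismConstraintSet X ∧
    ∃ f : α → Sym2 (Fin 6), IsGraphicRep N prismGraph f ∧ f '' Y = X)

section graphPart

/-- No pair `s, t` separates two sets that both contain a vertex outside `D`. -/
def NoSep {V : Type*} (D : Set V) (G : SimpleGraph V) : Prop :=
  ∀ A B : Set V, (∃ a ∈ A, a ∉ D) → (∃ b ∈ B, b ∉ D) → (∀ y, y ∈ A → y ∉ B) →
    (∀ a ∈ A, ∀ b ∈ B, ¬ G.Adj a b) → ∀ s t, ∃ y, y ∉ A ∧ y ∉ B ∧ y ≠ s ∧ y ≠ t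

theorem two_cover {V : Type*} {a b c s t : V} (ha : a ≠ s → a = t) (hb : b ≠ s → b = t)
    (hc : c ≠ s → c = t) (hab : a ≠ b) (hac : a ≠ c) (hbc : b ≠ c) : False := by
  by_cases h1 : a = s <;> by_cases h2 : b = s <;> by_cases h3 : c = s <;> simp_all

theorem kconn_iff {V : Type*} [Finite V] (G : SimpleGraph V) :
    KConnected 3 G ↔ 3 < Nat.card V ∧ NoSep ∅ G := by
  constructor
  · rintro ⟨hc, h⟩
    refine ⟨hc, ?_⟩
    rintro A B ⟨a, ha, -⟩ ⟨b, hb, -⟩ hAB hE s t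
    by_contra hcon
    push Not at hcon
    have hS : ({y | y ∉ A ∧ y ∉ B} : Set V).ncard < 3 := by
      have h1 : ({y | y ∉ A ∧ y ∉ B} : Set V) ⊆ {s, t} := by
        rintro y ⟨h1, h2⟩
        by_cases hys : y = s
        · simp [hys]
        · simp [hcon y h1 h2 hys]
      have := Set.ncard_le_ncard h1 (Set.toFinite _)
      have := Set.ncard_insert_le s {t}
      simp at this
      omega
    have hcn := (h _ hS).preconnected
    have key : ∀ x y : ↥({y | y ∉ A ∧ y ∉ B} : Set V)ᶜ,
        (G.induce ({y | y ∉ A ∧ y ∉ B} : Set V)ᶜ).Reachable x y → x.1 ∈ A → y.1 ∈ A := by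
      rintro x y ⟨p⟩
      induction p with
      | nil => exact id
      | cons hadj p ih =>
        rename_i u v w
        intro hu
        apply ih
        by_contra hv
        have hvB : v.1 ∈ B := by
          by_contra hvB
          exact v.2 ⟨hv, hvB⟩
        exact hE _ hu _ hvB hadj
    have hbA := key ⟨a, fun h => h.1 ha⟩ ⟨b, fun h => h.2 hb⟩ (hcn _ _) ha
    exact hAB _ hbA hb
  · rintro ⟨hc, h⟩
    refine ⟨hc, ?_⟩
    intro S hS
    have hne : Nonempty V := by
      by_contra hh
      rw [not_nonempty_iff] at hh
      simp at hc
    have hst : ∃ s t, S ⊆ {s, t} := by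
      have : S.ncard = 0 ∨ S.ncard = 1 ∨ S.ncard = 2 := by omega
      rcases this with h0 | h0 | h0
      · rw [Set.ncard_eq_zero (Set.toFinite _)] at h0
        obtain ⟨v⟩ := hne
        exact ⟨v, v, by simp [h0]⟩
      · obtain ⟨a, rfl⟩ := Set.ncard_eq_one.1 h0
        exact ⟨a, a, by simp⟩
      · obtain ⟨a, b, -, rfl⟩ := Set.ncard_eq_two.1 h0
        exact ⟨a, b, subset_rfl⟩
    obtain ⟨s, t, hst⟩ := hst
    have hne2 : Nonempty ↥Sᶜ := by
      by_contra hh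
      have : Sᶜ = ∅ := by
        rw [Set.eq_empty_iff_forall_notMem]
        intro x hx
        exact hh ⟨⟨x, hx⟩⟩
      have h2 : S = Set.univ := by simpa using this
      rw [h2, Set.ncard_univ] at hS
      omega
    refine { preconnected := ?_, nonempty := hne2 }
    intro a b
    by_contra hab
    obtain ⟨y, h1, h2, h3, h4⟩ := h
      {y | ∃ h : y ∈ Sᶜ, (G.induce Sᶜ).Reachable a ⟨y, h⟩}
      {y | ∃ h : y ∈ Sᶜ, ¬ (G.induce Sᶜ).Reachable a ⟨y, h⟩}
      ⟨a, ⟨a.2, Reachable.refl _⟩, by simp⟩ ⟨b, ⟨b.2, hab⟩, by simp⟩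
      (by rintro y ⟨h1, h2⟩ ⟨h3, h4⟩; exact h4 h2)
      (by
        rintro x ⟨h1, h2⟩ y ⟨h3, h4⟩ hadj
        apply h4
        refine h2.trans (Adj.reachable ?_)
        simpa using hadj) s t
    have hyS : y ∈ S := by
      by_contra hyS
      by_cases hr : (G.induce Sᶜ).Reachable a ⟨y, hyS⟩
      · exact h1 ⟨hyS, hr⟩
      · exact h2 ⟨hyS, hr⟩
    have := hst hyS
    simp at this
    tauto

/-- If the neighbourhood of `Z` is contained in `Z ∪ {s, t}` then `Z` covers the rest. -/
theorem nosep_small {V : Type*} {G : SimpleGraph V} (h : NoSep ∅ G) (Z : Set V) (s t y z : V)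
    (hz : z ∈ Z) (hN : ∀ x ∈ Z, ∀ w, G.Adj x w → w ∈ Z ∨ w = s ∨ w = t)
    (hy : y ∉ Z) (hys : y ≠ s) (hyt : y ≠ t) : False := by
  obtain ⟨x, h1, h2, h3, h4⟩ := h Z {w | w ∉ Z ∧ w ≠ s ∧ w ≠ t} ⟨z, hz, by simp⟩
    ⟨y, ⟨hy, hys, hyt⟩, by simp⟩ (fun y hy h => h.1 hy)
    (by
      rintro a ha b ⟨h1, h2, h3⟩ hadj
      rcases hN a ha b hadj with h | h | h <;> contradiction) s t
  exact h2 ⟨h1, h3, h4⟩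

theorem exists_nbr {V : Type*} [Finite V] {G : SimpleGraph V} (hc : 3 < Nat.card V)
    (h : NoSep ∅ G) (z s t : V) : ∃ x, G.Adj z x ∧ x ≠ s ∧ x ≠ t := by
  by_contra hcon
  push Not at hcon
  have : ∃ y, y ≠ z ∧ y ≠ s ∧ y ≠ t := by
    by_contra hh
    push Not at hh
    have h1 : (Set.univ : Set V) ⊆ {z, s, t} := by
      intro y _
      have := hh y
      simp only [Set.mem_insert_iff, Set.mem_singleton_iff]
      tauto
    have h2 := Set.ncard_le_ncard h1 (Set.toFinite _)
    have h3 := Set.ncard_insert_le z {s, t}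
    have h4 := Set.ncard_insert_le s {t}
    rw [Set.ncard_univ] at h2
    simp at h4
    omega
  obtain ⟨y, h1, h2, h3⟩ := this
  refine nosep_small h {z} s t y z rfl ?_ (by simpa using h1) h2 h3
  rintro x rfl w hw
  by_cases hs : w = s
  · simp [hs]
  · simp [hcon w hw hs]

theorem contractFun_ne {V : Type*} {u v : V} (huv : u ≠ v) {x : V} (h : x ≠ v) :
    contractFun huv x = ⟨x, h⟩ := by
  simp [contractFun, h]

theorem contractFun_self {V : Type*} {u v : V} (huv : u ≠ v) :
    contractFun huv v = ⟨u, huv⟩ := by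
  simp [contractFun]

theorem contract_adj {V : Type*} {G : SimpleGraph V} {u v : V} (huv : u ≠ v)
    {p q : {w : V // w ≠ v}} :
    (contractGraph G huv).Adj p q ↔
      p ≠ q ∧ ∃ a b, G.Adj a b ∧ contractFun huv a = p ∧ contractFun huv b = q := by
  unfold contractGraph
  rw [fromEdgeSet_adj, and_comm]
  refine and_congr_right fun hne => ?_
  constructor
  · rintro ⟨e, he, h⟩
    induction e with | _ a b
    rw [Sym2.map_mk, Sym2.eq_iff] at h
    rcases h with ⟨h1, h2⟩ | ⟨h1, h2⟩
    · exact ⟨a, b, he, h1, h2⟩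
    · exact ⟨b, a, G.adj_symm he, h2, h1⟩
  · rintro ⟨a, b, h, rfl, rfl⟩
    exact ⟨s(a, b), h, by simp⟩

theorem contract_adj_of {V : Type*} {G : SimpleGraph V} {u v : V} (huv : u ≠ v)
    {p q : V} (hp : p ≠ v) (hq : q ≠ v) (h : G.Adj p q) :
    (contractGraph G huv).Adj ⟨p, hp⟩ ⟨q, hq⟩ := by
  rw [contract_adj]
  refine ⟨fun hh => h.ne (by simpa using hh), p, q, h, ?_, ?_⟩ <;> rw [contractFun_ne]

theorem contract_adj_of' {V : Type*} {G : SimpleGraph V} {u v : V} (huv : u ≠ v)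
    {q : V} (hq : q ≠ v) (hqu : q ≠ u) (h : G.Adj v q) :
    (contractGraph G huv).Adj ⟨u, huv⟩ ⟨q, hq⟩ := by
  rw [contract_adj]
  refine ⟨fun hh => hqu (by simpa using hh.symm), v, q, h, ?_, ?_⟩
  · rw [contractFun_self]
  · rw [contractFun_ne]

theorem card_contract {V : Type*} [Finite V] (v : V) :
    Nat.card {w : V // w ≠ v} + 1 = Nat.card V := by
  classical
  have := Fintype.ofFinite V
  rw [Nat.card_eq_fintype_card, Nat.card_eq_fintype_card]
  have : 0 < Fintype.card V := Fintype.card_pos_iff.2 ⟨v⟩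
  simp [Fintype.card_subtype_compl]
  omega

/-- Suppressing a degree-two vertex `u` by contracting it onto its neighbour `x`. -/
theorem nosep_contract {V : Type*} {G : SimpleGraph V} {D : Set V} {x u x' : V} (hxu : x ≠ u)
    (hN : ∀ t, G.Adj u t → t = x ∨ t = x') (hadj : G.Adj u x)
    (h : NoSep D G) :
    NoSep {w : {w : V // w ≠ u} | w.1 ∈ D} (contractGraph G hxu) := by
  -- it suffices to put `u` on a suitable side
  rintro A B ⟨a, ha, haD⟩ ⟨b, hb, hbD⟩ hAB hE s t
  have main : ∀ A' B' : Set V, (∀ y (hy : y ≠ u), y ∈ A' ↔ ⟨y, hy⟩ ∈ A) →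
      (∀ y (hy : y ≠ u), y ∈ B' ↔ ⟨y, hy⟩ ∈ B) → (u ∈ A' → u ∉ B') → (u ∈ A' ∨ u ∈ B') →
      (u ∈ A' → x ∉ B' ∧ x' ∉ B') → (u ∈ B' → x ∉ A' ∧ x' ∉ A') →
      ∃ y, y ∉ A ∧ y ∉ B ∧ y ≠ s ∧ y ≠ t := by
    intro A' B' hA hB h1 h2 h3 h4
    obtain ⟨y, g1, g2, g3, g4⟩ := h A' B' ⟨a.1, (hA _ a.2).2 ha, haD⟩ ⟨b.1, (hB _ b.2).2 hb, hbD⟩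
      (by
        intro y hy hy'
        by_cases hyu : y = u
        · subst hyu; exact h1 hy hy'
        · exact hAB _ ((hA y hyu).1 hy) ((hB y hyu).1 hy'))
      (by
        intro p hp q hq hpq
        by_cases hpu : p = u
        · subst hpu
          rcases hN q hpq with rfl | rfl
          · exact (h3 hp).1 hq
          · exact (h3 hp).2 hq
        · by_cases hqu : q = u
          · subst hqu
            rcases hN p hpq.symm with rfl | rfl
            · exact (h4 hq).1 hp
            · exact (h4 hq).2 hp
          · exact hE _ ((hA p hpu).1 hp) _ ((hB q hqu).1 hq) (contract_adj_of hxu hpu hqu hpq))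
      s.1 t.1
    have hyu : y ≠ u := by rintro rfl; tauto
    refine ⟨⟨y, hyu⟩, fun h => g1 ((hA _ _).2 h), fun h => g2 ((hB _ _).2 h), ?_, ?_⟩
    · rintro rfl; exact g3 rfl
    · rintro rfl; exact g4 rfl
  -- if `u` has a neighbour `x'` as well, then `x` and `x'` are not on opposite sides
  by_cases hx' : G.Adj u x' ∧ x' ≠ x
  · have hx'u : x' ≠ u := hx'.1.ne'
    have hxx' : (contractGraph G hxu).Adj ⟨x, hxu⟩ ⟨x', hx'u⟩ :=
      contract_adj_of' hxu hx'u hx'.2 hx'.1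
    by_cases hside : (⟨x, hxu⟩ : {w : V // w ≠ u}) ∈ B ∨ (⟨x', hx'u⟩ : {w : V // w ≠ u}) ∈ B
    · refine main {y | ∃ hy : y ≠ u, ⟨y, hy⟩ ∈ A} {y | y = u ∨ ∃ hy : y ≠ u, ⟨y, hy⟩ ∈ B}
        (by simp +contextual) (by simp +contextual) (by simp) (by simp) (by simp) ?_
      rintro -
      have e1 := hE ⟨x, hxu⟩
      have e2 := hE ⟨x', hx'u⟩
      have e3 := hAB ⟨x, hxu⟩
      have e4 := hAB ⟨x', hx'u⟩
      constructor
      · rintro ⟨_, hx⟩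
        rcases hside with hs | hs
        · exact e3 hx hs
        · exact e1 hx _ hs hxx'
      · rintro ⟨_, hx⟩
        rcases hside with hs | hs
        · exact e2 hx _ hs hxx'.symm
        · exact e4 hx hs
    · refine main {y | y = u ∨ ∃ hy : y ≠ u, ⟨y, hy⟩ ∈ A} {y | ∃ hy : y ≠ u, ⟨y, hy⟩ ∈ B}
        (by simp +contextual) (by simp +contextual) (by simp) (by simp) ?_ (by simp)
      rintro -
      push Not at hside
      constructor
      · rintro ⟨_, hx⟩; exact hside.1 hx
      · rintro ⟨_, hx⟩; exact hside.2 hx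
  · have hN' : ∀ t, G.Adj u t → t = x := by
      intro t ht
      rcases hN t ht with h | rfl
      · exact h
      · by_contra hne
        exact hx' ⟨ht, hne⟩
    have := hN
    clear hN
    -- only one neighbour: reduce to the same argument with `x' = x`
    by_cases hside : (⟨x, hxu⟩ : {w : V // w ≠ u}) ∈ B
    · obtain ⟨y, g1, g2, g3, g4⟩ := h {y | ∃ hy : y ≠ u, ⟨y, hy⟩ ∈ A}
        {y | y = u ∨ ∃ hy : y ≠ u, ⟨y, hy⟩ ∈ B} ⟨a.1, ⟨a.2, ha⟩, haD⟩ ⟨b.1, Or.inr ⟨b.2, hb⟩, hbD⟩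
        (by
          rintro y ⟨h1, h2⟩ (rfl | ⟨h3, h4⟩)
          · exact h1 rfl
          · exact hAB _ h2 h4)
        (by
          rintro p ⟨h1, h2⟩ q (rfl | ⟨h3, h4⟩) hpq
          · have := hN' p hpq.symm
            subst this
            exact hAB _ h2 hside
          · exact hE _ h2 _ h4 (contract_adj_of hxu h1 h3 hpq)) s.1 t.1
      have hyu : y ≠ u := fun h => g2 (Or.inl h)
      refine ⟨⟨y, hyu⟩, fun h => g1 ⟨hyu, h⟩, fun h => g2 (Or.inr ⟨hyu, h⟩), ?_, ?_⟩
      · rintro rfl; exact g3 rfl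
      · rintro rfl; exact g4 rfl
    · obtain ⟨y, g1, g2, g3, g4⟩ := h {y | y = u ∨ ∃ hy : y ≠ u, ⟨y, hy⟩ ∈ A}
        {y | ∃ hy : y ≠ u, ⟨y, hy⟩ ∈ B} ⟨a.1, Or.inr ⟨a.2, ha⟩, haD⟩ ⟨b.1, ⟨b.2, hb⟩, hbD⟩
        (by
          rintro y (rfl | ⟨h3, h4⟩) ⟨h1, h2⟩
          · exact h1 rfl
          · exact hAB _ h4 h2)
        (by
          rintro p (rfl | ⟨h3, h4⟩) q ⟨h1, h2⟩ hpq
          · have := hN' q hpq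
            subst this
            exact hside h2
          · exact hE _ h4 _ h2 (contract_adj_of hxu h3 h1 hpq)) s.1 t.1
      have hyu : y ≠ u := fun h => g1 (Or.inl h)
      refine ⟨⟨y, hyu⟩, fun h => g1 (Or.inr ⟨hyu, h⟩), fun h => g2 ⟨hyu, h⟩, ?_, ?_⟩
      · rintro rfl; exact g3 rfl
      · rintro rfl; exact g4 rfl

/-- If `G/uv` is not 3-connected, then `u, v` lie in a separator of size three. -/
theorem exists_separator {V : Type*} [Finite V] {G : SimpleGraph V} (hc : 4 < Nat.card V)
    (h : NoSep ∅ G) {u v : V} (huv : u ≠ v) (hn : ¬ KConnected 3 (contractGraph G huv)) :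
    ∃ (w : V) (P Q : Set V), P.Nonempty ∧ Q.Nonempty ∧ w ≠ u ∧ w ≠ v ∧
      (∀ y, y ∈ P → y ∉ Q) ∧ (∀ y, (y = u ∨ y = v ∨ y = w) ↔ (y ∉ P ∧ y ∉ Q)) ∧
      ∀ p ∈ P, ∀ q ∈ Q, ¬ G.Adj p q := by
  rw [kconn_iff] at hn
  have hcc := card_contract v
  have hns : ¬ NoSep ∅ (contractGraph G huv) := fun h' => hn ⟨by omega, h'⟩
  unfold NoSep at hns
  push Not at hns
  obtain ⟨A, B, ⟨a, ha, -⟩, ⟨b, hb, -⟩, hAB, hE, s, t, hst⟩ := hns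
  have huA : ⟨u, huv⟩ ∉ A := by
    intro huA
    obtain ⟨y, g1, g2, g3, g4⟩ := h {y | y = v ∨ ∃ hy : y ≠ v, ⟨y, hy⟩ ∈ A}
        {y | ∃ hy : y ≠ v, ⟨y, hy⟩ ∈ B} ⟨a.1, Or.inr ⟨a.2, ha⟩, by simp⟩ ⟨b.1, ⟨b.2, hb⟩, by simp⟩
        (by
          rintro y (rfl | ⟨h3, h4⟩) ⟨h1, h2⟩
          · exact h1 rfl
          · exact hAB _ h4 h2)
        (by
          rintro p (rfl | ⟨h3, h4⟩) q ⟨h1, h2⟩ hpq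
          · have hqu : q ≠ u := by rintro rfl; exact hAB _ huA h2
            exact hE _ huA _ h2 (contract_adj_of' huv h1 hqu hpq)
          · exact hE _ h4 _ h2 (contract_adj_of huv h3 h1 hpq)) s.1 t.1
    have hyv : y ≠ v := fun h => g1 (Or.inl h)
    have := hst ⟨y, hyv⟩ (fun h => g1 (Or.inr ⟨hyv, h⟩)) (fun h => g2 ⟨hyv, h⟩)
      (by rintro rfl; exact g3 rfl)
    exact g4 (by rw [← this])
  have huB : ⟨u, huv⟩ ∉ B := by
    intro huB
    obtain ⟨y, g1, g2, g3, g4⟩ := h {y | ∃ hy : y ≠ v, ⟨y, hy⟩ ∈ A}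
        {y | y = v ∨ ∃ hy : y ≠ v, ⟨y, hy⟩ ∈ B} ⟨a.1, ⟨a.2, ha⟩, by simp⟩ ⟨b.1, Or.inr ⟨b.2, hb⟩, by simp⟩
        (by
          rintro y ⟨h1, h2⟩ (rfl | ⟨h3, h4⟩)
          · exact h1 rfl
          · exact hAB _ h2 h4)
        (by
          rintro p ⟨h1, h2⟩ q (rfl | ⟨h3, h4⟩) hpq
          · have hqu : p ≠ u := by rintro rfl; exact hAB _ h2 huB
            exact hE _ h2 _ huB (contract_adj_of' huv h1 hqu hpq.symm).symm
          · exact hE _ h2 _ h4 (contract_adj_of huv h1 h3 hpq)) s.1 t.1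
    have hyv : y ≠ v := fun h => g2 (Or.inl h)
    have := hst ⟨y, hyv⟩ (fun h => g1 ⟨hyv, h⟩) (fun h => g2 (Or.inr ⟨hyv, h⟩))
      (by rintro rfl; exact g3 rfl)
    exact g4 (by rw [← this])
  obtain ⟨w, g1, g2, g3, g4⟩ := h {y | ∃ hy : y ≠ v, ⟨y, hy⟩ ∈ A}
        {y | ∃ hy : y ≠ v, ⟨y, hy⟩ ∈ B} ⟨a.1, ⟨a.2, ha⟩, by simp⟩ ⟨b.1, ⟨b.2, hb⟩, by simp⟩
        (by
          rintro y ⟨h1, h2⟩ ⟨h3, h4⟩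
          exact hAB _ h2 h4)
        (by
          rintro p ⟨h1, h2⟩ q ⟨h3, h4⟩ hpq
          exact hE _ h2 _ h4 (contract_adj_of huv h1 h3 hpq)) u v
  have hw : ⟨w, g4⟩ ∉ A ∧ ⟨w, g4⟩ ∉ B := ⟨fun h => g1 ⟨g4, h⟩, fun h => g2 ⟨g4, h⟩⟩
  refine ⟨w, {y | ∃ hy : y ≠ v, ⟨y, hy⟩ ∈ A}, {y | ∃ hy : y ≠ v, ⟨y, hy⟩ ∈ B},
    ⟨a.1, a.2, ha⟩, ⟨b.1, b.2, hb⟩, g3, g4, ?_, ?_, ?_⟩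
  · rintro y ⟨h1, h2⟩ ⟨h3, h4⟩
    exact hAB _ h2 h4
  · intro y
    constructor
    · rintro (rfl | rfl | rfl)
      · exact ⟨fun ⟨_, h⟩ => huA h, fun ⟨_, h⟩ => huB h⟩
      · exact ⟨fun ⟨h, _⟩ => h rfl, fun ⟨h, _⟩ => h rfl⟩
      · exact ⟨g1, g2⟩
    · rintro ⟨h1, h2⟩
      by_cases hyv : y = v
      · simp [hyv]
      have k1 := hst ⟨y, hyv⟩ (fun h => h1 ⟨hyv, h⟩) (fun h => h2 ⟨hyv, h⟩)
      have k2 := hst ⟨w, g4⟩ hw.1 hw.2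
      have k3 := hst ⟨u, huv⟩ huA huB
      have k4 : (⟨w, g4⟩ : {x : V // x ≠ v}) ≠ ⟨u, huv⟩ := by simpa using g3
      by_contra hh
      push Not at hh
      have k5 : (⟨y, hyv⟩ : {x : V // x ≠ v}) ≠ ⟨u, huv⟩ := by simpa using hh.1
      have k6 : (⟨y, hyv⟩ : {x : V // x ≠ v}) ≠ ⟨w, g4⟩ := by simpa using hh.2.2
      exact two_cover k1 k2 k3 k6 k5 k4
  · rintro p ⟨h1, h2⟩ q ⟨h3, h4⟩ hpq
    exact hE _ h2 _ h4 (contract_adj_of huv h1 h3 hpq)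

end graphPart

section deletion

/-- `z` has at most two neighbours other than `o`. -/
def SmallAt {V : Type*} (G : SimpleGraph V) (z o : V) : Prop :=
  ∃ p q, ∀ t, G.Adj z t → t = o ∨ t = p ∨ t = q

/-- `{u, v, w}` separates `P` from `Q`. -/
def Sep3 {V : Type*} (G : SimpleGraph V) (u v w : V) (P Q : Set V) : Prop :=
  P.Nonempty ∧ Q.Nonempty ∧ w ≠ u ∧ w ≠ v ∧
      (∀ y, y ∈ P → y ∉ Q) ∧ (∀ y, (y = u ∨ y = v ∨ y = w) ↔ (y ∉ P ∧ y ∉ Q)) ∧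
      ∀ p ∈ P, ∀ q ∈ Q, ¬ G.Adj p q

theorem Sep3.swap {V : Type*} {G : SimpleGraph V} {u v w : V} {P Q : Set V}
    (h : Sep3 G u v w P Q) : Sep3 G v u w P Q := by
  obtain ⟨h1, h2, h3, h4, h5, h6, h7⟩ := h
  refine ⟨h1, h2, h4, h3, h5, ?_, h7⟩
  intro y
  rw [← h6]
  tauto

theorem Sep3.symm {V : Type*} {G : SimpleGraph V} {u v w : V} {P Q : Set V}
    (h : Sep3 G u v w P Q) : Sep3 G u v w Q P := by
  obtain ⟨h1, h2, h3, h4, h5, h6, h7⟩ := h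
  refine ⟨h2, h1, h3, h4, fun y hy hy' => h5 y hy' hy, ?_, fun p hp q hq h => h7 q hq p hp h.symm⟩
  intro y
  rw [h6]
  tauto

/-- Any separation of `G - uv` contains a vertex of `P` in its separator. -/
theorem sep_meets {V : Type*} {G : SimpleGraph V} (h : NoSep ∅ G) {u v w : V} (huv : u ≠ v)
    {P Q : Set V} (hs : Sep3 G u v w P Q) {A B : Set V} (hu : u ∈ A) (hv : v ∈ B)
    (hE : ∀ a ∈ A, ∀ b ∈ B, G.Adj a b → a = u ∧ b = v) :
    ∃ p ∈ P, p ∉ A ∧ p ∉ B := by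
  by_contra hcon
  push Not at hcon
  obtain ⟨⟨p, hp⟩, h2, h3, h4, h5, h6, h7⟩ := hs
  have huP := (h6 u).1 (by simp)
  have hvP := (h6 v).1 (by simp)
  have hwP := (h6 w).1 (by simp)
  by_cases hpA : p ∈ A
  · refine nosep_small h (P ∩ A) u w v p ⟨hp, hpA⟩ ?_ (fun h => hvP.1 h.1) huv.symm h4.symm
    rintro x ⟨hxP, hxA⟩ y hxy
    have hxu : x ≠ u := by rintro rfl; exact huP.1 hxP
    have k1 : y ∉ B := fun hy => hxu (hE x hxA y hy hxy).1
    have k2 : y ∉ Q := fun hy => h7 x hxP y hy hxy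
    by_cases hyP : y ∈ P
    · left
      refine ⟨hyP, ?_⟩
      by_contra hyA
      exact k1 (hcon y hyP hyA)
    · rcases (h6 y).2 ⟨hyP, k2⟩ with rfl | rfl | rfl
      · simp
      · contradiction
      · simp
  · have hpB := hcon p hp hpA
    refine nosep_small h (P ∩ B) v w u p ⟨hp, hpB⟩ ?_ (fun h => huP.1 h.1) huv h3.symm
    rintro x ⟨hxP, hxB⟩ y hxy
    have hxv : x ≠ v := by rintro rfl; exact hvP.1 hxP
    have k1 : y ∉ A := fun hy => hxv (hE y hy x hxB hxy.symm).2
    have k2 : y ∉ Q := fun hy => h7 x hxP y hy hxy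
    by_cases hyP : y ∈ P
    · left
      exact ⟨hyP, hcon y hyP k1⟩
    · rcases (h6 y).2 ⟨hyP, k2⟩ with rfl | rfl | rfl
      · contradiction
      · simp
      · simp

theorem side_empty {V : Type*} {G : SimpleGraph V} (h : NoSep ∅ G) {u v w : V} (huv : u ≠ v)
    {P Q : Set V} (hs : Sep3 G u v w P Q) {A B : Set V} (hu : u ∈ A)
    (hE : ∀ a ∈ A, ∀ b ∈ B, G.Adj a b → a = u ∧ b = v)
    (hw : w ∈ A) (p : V) (hpP : p ∈ P) (hpS : ∀ y ∈ P, y ∉ A → y ∉ B → y = p) :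
    ∀ y ∈ P, y ∉ B := by
  intro z hzP hzB
  obtain ⟨-, h2, h3, h4, h5, h6, h7⟩ := hs
  have huP := (h6 u).1 (by simp)
  have hvP := (h6 v).1 (by simp)
  refine nosep_small h (P ∩ B) v p u z ⟨hzP, hzB⟩ ?_ (fun h => huP.1 h.1) huv
    (by rintro rfl; exact huP.1 hpP)
  rintro x ⟨hxP, hxB⟩ y hxy
  have hxv : x ≠ v := by rintro rfl; exact hvP.1 hxP
  have k1 : y ∉ A := fun hy => hxv (hE y hy x hxB hxy.symm).2
  have k2 : y ∉ Q := fun hy => h7 x hxP y hy hxy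
  by_cases hyP : y ∈ P
  · by_cases hyB : y ∈ B
    · exact Or.inl ⟨hyP, hyB⟩
    · exact Or.inr (Or.inr (hpS y hyP k1 hyB))
  · rcases (h6 y).2 ⟨hyP, k2⟩ with rfl | rfl | rfl
    · contradiction
    · simp
    · contradiction

theorem side_small {V : Type*} {G : SimpleGraph V} (h : NoSep ∅ G) {u v w : V} (huv : u ≠ v)
    {P Q : Set V} (hs : Sep3 G u v w P Q) {A B : Set V} (hu : u ∈ A) (hv : v ∈ B)
    (hAB : ∀ y, y ∈ A → y ∉ B) (hE : ∀ a ∈ A, ∀ b ∈ B, G.Adj a b → a = u ∧ b = v)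
    (hw : w ∈ A) (s t : V) (hst : ∀ y, y ∉ A → y ∉ B → y = s ∨ y = t) :
    (∀ y ∈ B, y = v) ∧ SmallAt G v u := by
  obtain ⟨p, hpP, hpA, hpB⟩ := sep_meets h huv hs hu hv hE
  obtain ⟨q, hqQ, hqA, hqB⟩ := sep_meets h huv hs.symm hu hv hE
  have hdis := hs.2.2.2.2.1
  have hpq : p ≠ q := by rintro rfl; exact hdis p hpP hqQ
  have hS : ∀ y, y ∉ A → y ∉ B → y = p ∨ y = q := by
    intro y h1 h2
    have e1 := hst y h1 h2
    have e2 := hst p hpA hpB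
    have e3 := hst q hqA hqB
    grind
  have hP := side_empty h huv hs hu hE hw p hpP (by
    intro y hy h1 h2
    rcases hS y h1 h2 with h | rfl
    · exact h
    · exact absurd hqQ (hdis _ hy))
  have hQ := side_empty h huv hs.symm hu hE hw q hqQ (by
    intro y hy h1 h2
    rcases hS y h1 h2 with rfl | h
    · exact absurd hy (hdis _ hpP)
    · exact h)
  have hB : ∀ y ∈ B, y = v := by
    intro y hy
    have k := (hs.2.2.2.2.2.1 y).2 ⟨fun h => hP y h hy, fun h => hQ y h hy⟩
    rcases k with rfl | h | rfl
    · exact absurd hy (hAB _ hu)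
    · exact h
    · exact absurd hy (hAB _ hw)
  refine ⟨hB, p, q, ?_⟩
  intro t ht
  by_cases htA : t ∈ A
  · exact Or.inl (hE t htA v hv ht.symm).1
  · by_cases htB : t ∈ B
    · exact absurd (hB t htB) ht.ne'
    · exact Or.inr (hS t htA htB)

theorem nosep_delete {V : Type*} {G : SimpleGraph V} (h : NoSep ∅ G) {u v w : V} (huv : u ≠ v)
    {P Q : Set V} (hs : Sep3 G u v w P Q) :
    NoSep {z | (z = u ∧ SmallAt G u v) ∨ (z = v ∧ SmallAt G v u)} (G.deleteEdges {s(u, v)}) := by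
  have main : ∀ (A B : Set V), (∃ a ∈ A, ¬ (a = u ∧ SmallAt G u v)) →
      (∃ a ∈ B, ¬ (a = v ∧ SmallAt G v u)) → u ∈ A → v ∈ B → (∀ y, y ∈ A → y ∉ B) →
      (∀ a ∈ A, ∀ b ∈ B, ¬ (G.deleteEdges {s(u, v)}).Adj a b) →
      ∀ s t, ∃ y, y ∉ A ∧ y ∉ B ∧ y ≠ s ∧ y ≠ t := by
    rintro A B ⟨a, ha, haD⟩ ⟨b, hb, hbD⟩ hu hv hAB hE s t
    by_contra hcon
    push Not at hcon
    have hst : ∀ y, y ∉ A → y ∉ B → y = s ∨ y = t := by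
      intro y h1 h2
      by_contra hh
      push Not at hh
      exact hh.2 (hcon y h1 h2 hh.1)
    have hE' : ∀ a ∈ A, ∀ b ∈ B, G.Adj a b → a = u ∧ b = v := by
      intro a ha b hb hab
      have := hE a ha b hb
      rw [deleteEdges_adj] at this
      simp only [hab, true_and, Set.mem_singleton_iff, not_not, Sym2.eq_iff] at this
      rcases this with h | ⟨rfl, rfl⟩
      · exact h
      · exact absurd hb (hAB _ hu)
    by_cases hwA : w ∈ A
    · obtain ⟨k1, k2⟩ := side_small h huv hs hu hv hAB hE' hwA s t hst
      exact hbD ⟨k1 b hb, k2⟩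
    · by_cases hwB : w ∈ B
      · obtain ⟨k1, k2⟩ := side_small h huv.symm hs.swap hv hu (fun y h1 h2 => hAB y h2 h1)
          (fun b hb a ha hab => (hE' a ha b hb hab.symm).symm) hwB s t (fun y h1 h2 => hst y h2 h1)
        exact haD ⟨k1 a ha, k2⟩
      · obtain ⟨p, hpP, hpA, hpB⟩ := sep_meets h huv hs hu hv hE'
        obtain ⟨q, hqQ, hqA, hqB⟩ := sep_meets h huv hs.symm hu hv hE'
        have k := (hs.2.2.2.2.2.1 w).1 (by simp)
        have hpq : p ≠ q := by rintro rfl; exact hs.2.2.2.2.1 p hpP hqQ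
        have hpw : p ≠ w := by rintro rfl; exact k.1 hpP
        have hqw : q ≠ w := by rintro rfl; exact k.2 hqQ
        have e1 := hst w hwA hwB
        have e2 := hst p hpA hpB
        have e3 := hst q hqA hqB
        grind
  rintro A B ⟨a, ha, haD⟩ ⟨b, hb, hbD⟩ hAB hE s t
  simp only [Set.mem_ofPred_eq, not_or] at haD hbD
  by_cases h1 : u ∈ A ∧ v ∈ B
  · exact main A B ⟨a, ha, haD.1⟩ ⟨b, hb, hbD.2⟩ h1.1 h1.2 hAB hE s t
  · by_cases h2 : u ∈ B ∧ v ∈ A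
    · obtain ⟨y, k1, k2, k3⟩ := main B A ⟨b, hb, hbD.1⟩ ⟨a, ha, haD.2⟩ h2.1 h2.2
        (fun y h1 h2 => hAB y h2 h1) (fun b hb a ha hab => hE a ha b hb hab.symm) s t
      exact ⟨y, k2, k1, k3⟩
    · refine h A B ⟨a, ha, by simp⟩ ⟨b, hb, by simp⟩ hAB ?_ s t
      intro a ha b hb hab
      apply hE a ha b hb
      rw [deleteEdges_adj]
      refine ⟨hab, ?_⟩
      simp only [Set.mem_singleton_iff, Sym2.eq_iff]
      rintro (⟨rfl, rfl⟩ | ⟨rfl, rfl⟩)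
      · exact h1 ⟨ha, hb⟩
      · exact h2 ⟨hb, ha⟩

/-- a small end `u` is not adjacent to `w` -/
theorem small_not_adj {V : Type*} {G : SimpleGraph V} (h : NoSep ∅ G) {u v w : V} (huv : u ≠ v)
    {P Q : Set V} (hs : Sep3 G u v w P Q) (hsm : SmallAt G u v) : ¬ G.Adj u w := by
  have key : ∀ {P Q : Set V}, Sep3 G u v w P Q → ∃ p ∈ P, G.Adj u p := by
    intro P Q hs
    by_contra hcon
    push Not at hcon
    obtain ⟨⟨p, hp⟩, h2, h3, h4, h5, h6, h7⟩ := hs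
    have huP := (h6 u).1 (by simp)
    refine nosep_small h P v w u p hp ?_ huP.1 huv h3.symm
    intro x hx y hxy
    by_cases hyP : y ∈ P
    · exact Or.inl hyP
    · rcases (h6 y).2 ⟨hyP, fun hy => h7 x hx y hy hxy⟩ with rfl | rfl | rfl
      · exact absurd hxy.symm (hcon x hx)
      · simp
      · simp
  intro huw
  obtain ⟨p, hpP, hp⟩ := key hs
  obtain ⟨q, hqQ, hq⟩ := key hs.symm
  obtain ⟨h1, h2, h3, h4, h5, h6, h7⟩ := hs
  have kv := (h6 v).1 (by simp)
  have kw := (h6 w).1 (by simp)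
  have hpq : p ≠ q := by rintro rfl; exact h5 p hpP hqQ
  have hpw : p ≠ w := by rintro rfl; exact kw.1 hpP
  have hqw : q ≠ w := by rintro rfl; exact kw.2 hqQ
  have hpv : p ≠ v := by rintro rfl; exact kv.1 hpP
  have hqv : q ≠ v := by rintro rfl; exact kv.2 hqQ
  obtain ⟨s, t, hst⟩ := hsm
  have e1 := hst w huw
  have e2 := hst p hp
  have e3 := hst q hq
  grind

theorem card_six {V : Type*} [Finite V] {G : SimpleGraph V} (hc : 3 < Nat.card V)
    (h : NoSep ∅ G) {u v w : V} (huv : u ≠ v)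
    {P Q : Set V} (hs : Sep3 G u v w P Q) (hu : SmallAt G u v) (hv : SmallAt G v u) :
    5 < Nat.card V := by
  have huw := small_not_adj h huv hs hu
  have hvw := small_not_adj h huv.symm hs.swap hv
  obtain ⟨a, ha, -, -⟩ := exists_nbr hc h w w w
  obtain ⟨b, hb, hba, -⟩ := exists_nbr hc h w a a
  obtain ⟨c, hcw, hca, hcb⟩ := exists_nbr hc h w a b
  have hwu := hs.2.2.1
  have hwv := hs.2.2.2.1
  have hn : ∀ x, G.Adj w x → x ≠ u ∧ x ≠ v ∧ x ≠ w := by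
    intro x hx
    refine ⟨?_, ?_, hx.ne'⟩
    · rintro rfl; exact huw hx.symm
    · rintro rfl; exact hvw hx.symm
  have na := hn a ha
  have nb := hn b hb
  have nc := hn c hcw
  have hinj : Function.Injective ![u, v, w, a, b, c] := by
    intro i j hij
    fin_cases i <;> fin_cases j <;> simp at hij ⊢ <;> grind
  have := Nat.card_le_card_of_injective _ hinj
  simp at this
  omega

end deletion

section constraintPart

/-- `K` witnesses that `X` is disconnected: it is a union of components (and uncovered vertices),
`ab` is an edge of `X` inside, and `cd` one outside. -/
structure Disc {V : Type*} (X : Set (Sym2 V)) (K : Set V) (a b c d : V) : Prop where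
  closed : ∀ p q, s(p, q) ∈ X → (p ∈ K ↔ q ∈ K)
  ab : a ≠ b
  hab : s(a, b) ∈ X
  ha : a ∈ K
  cd : c ≠ d
  hcd : s(c, d) ∈ X
  hc : c ∉ K

theorem mem_supp {V : Type*} {X : Set (Sym2 V)} {x : V} :
    x ∈ (fromEdgeSet X).support ↔ ∃ y, s(x, y) ∈ X ∧ x ≠ y := by
  rw [mem_support]
  simp only [fromEdgeSet_adj]

theorem nosep_empty {V : Type*} {G : SimpleGraph V} {D : Set V} (h : NoSep D G)
    (hD : ∀ z, z ∉ D) : NoSep ∅ G :=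
  fun A B ⟨a, ha, _⟩ ⟨b, hb, _⟩ => h A B ⟨a, ha, hD a⟩ ⟨b, hb, hD b⟩

theorem closed_reach {V : Type*} {X : Set (Sym2 V)} {K : Set V}
    (h : ∀ p q, s(p, q) ∈ X → (p ∈ K ↔ q ∈ K)) {p q : V}
    (hr : (fromEdgeSet X).Reachable p q) : p ∈ K ↔ q ∈ K := by
  obtain ⟨w⟩ := hr
  induction w with
  | nil => exact Iff.rfl
  | cons hadj w ih =>
    rw [fromEdgeSet_adj] at hadj
    exact (h _ _ hadj.1).trans ih

theorem Disc.not_conn {V : Type*} {X : Set (Sym2 V)} {K : Set V} {a b c d : V}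
    (h : Disc X K a b c d) : ¬ EdgeSetConnected X := by
  intro hc
  have := hc a (mem_supp.2 ⟨b, h.hab, h.ab⟩) c (mem_supp.2 ⟨d, h.hcd, h.cd⟩)
  exact h.hc ((closed_reach h.closed this).1 h.ha)

theorem reach_closed {V : Type*} (X : Set (Sym2 V)) (z : V) (p q : V) (h : s(p, q) ∈ X) :
    (fromEdgeSet X).Reachable z p ↔ (fromEdgeSet X).Reachable z q := by
  by_cases hpq : p = q
  · rw [hpq]
  · have : (fromEdgeSet X).Adj p q := by rw [fromEdgeSet_adj]; exact ⟨h, hpq⟩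
    exact ⟨fun h => h.trans this.reachable, fun h => h.trans this.symm.reachable⟩

theorem exists_disc {V : Type*} {X : Set (Sym2 V)} (h : ¬ EdgeSetConnected X) :
    ∃ K a b c d, Disc X K a b c d := by
  unfold EdgeSetConnected at h
  push Not at h
  obtain ⟨a, ha, c, hc, hac⟩ := h
  obtain ⟨b, hab⟩ := mem_supp.1 ha
  obtain ⟨d, hcd⟩ := mem_supp.1 hc
  exact ⟨{z | (fromEdgeSet X).Reachable a z}, a, b, c, d,
    ⟨fun p q h => reach_closed X a p q h, hab.2, hab.1, Reachable.refl _, hcd.2, hcd.1, hac⟩⟩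

theorem Disc.compl {V : Type*} {X : Set (Sym2 V)} {K : Set V} {a b c d : V}
    (h : Disc X K a b c d) : Disc X Kᶜ c d a b :=
  ⟨fun p q hpq => not_congr (h.closed p q hpq), h.cd, h.hcd, h.hc, h.ab, h.hab, fun hh => hh h.ha⟩

theorem Disc.ne {V : Type*} {X : Set (Sym2 V)} {K : Set V} {a b c d : V}
    (h : Disc X K a b c d) : a ≠ c ∧ a ≠ d ∧ b ≠ c ∧ b ≠ d := by
  have hb := (h.closed _ _ h.hab).1 h.ha
  have hd := fun hh => h.hc ((h.closed _ _ h.hcd).2 hh)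
  have ha := h.ha
  have hc := h.hc
  refine ⟨?_, ?_, ?_, ?_⟩ <;> rintro rfl <;> contradiction

/-- the constraint of a contraction -/
def contrX {V : Type*} (X : Set (Sym2 V)) {x u : V} (hxu : x ≠ u) : Set (Sym2 {w : V // w ≠ u}) :=
  {e | e ∈ Sym2.map (contractFun hxu) '' X ∧ ¬ e.IsDiag}

theorem contractFun_eq {V : Type*} {x u : V} (hxu : x ≠ u) {a b : V} (hab : a ≠ b)
    (h : contractFun hxu a = contractFun hxu b) : s(u, x) = s(a, b) := by
  rw [Sym2.eq_iff]
  by_cases ha : a = u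
  · subst ha
    have hb : b ≠ a := hab.symm
    rw [contractFun_self, contractFun_ne hxu hb] at h
    simp at h
    exact Or.inl ⟨rfl, h⟩
  · by_cases hb : b = u
    · subst hb
      rw [contractFun_self, contractFun_ne hxu ha] at h
      simp at h
      exact Or.inr ⟨rfl, h.symm⟩
    · rw [contractFun_ne hxu ha, contractFun_ne hxu hb] at h
      simp at h
      contradiction

theorem contractFun_mem {V : Type*} {x u : V} (hxu : x ≠ u) {K : Set V} (hK : x ∈ K ↔ u ∈ K)
    (a : V) : (contractFun hxu a).1 ∈ K ↔ a ∈ K := by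
  by_cases ha : a = u
  · subst ha
    rw [contractFun_self]
    exact hK
  · rw [contractFun_ne hxu ha]

theorem Disc.contract {V : Type*} {X : Set (Sym2 V)} {K : Set V} {a b c d : V}
    (h : Disc X K a b c d) {x u : V} (hxu : x ≠ u) (hK : x ∈ K ↔ u ∈ K)
    (h1 : s(u, x) ≠ s(a, b)) (h2 : s(u, x) ≠ s(c, d)) :
    Disc (contrX X hxu) {w | w.1 ∈ K} (contractFun hxu a) (contractFun hxu b)
      (contractFun hxu c) (contractFun hxu d) := by
  have e1 : contractFun hxu a ≠ contractFun hxu b := fun hh => h1 (contractFun_eq hxu h.ab hh)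
  have e2 : contractFun hxu c ≠ contractFun hxu d := fun hh => h2 (contractFun_eq hxu h.cd hh)
  refine ⟨?_, e1, ⟨⟨_, h.hab, by simp⟩, by simpa using e1⟩, (contractFun_mem hxu hK a).2 h.ha,
    e2, ⟨⟨_, h.hcd, by simp⟩, by simpa using e2⟩, fun hh => h.hc ((contractFun_mem hxu hK c).1 hh)⟩
  rintro p q ⟨⟨e, he, hpq⟩, -⟩
  induction e with | _ y z
  rw [Sym2.map_mk, Sym2.eq_iff] at hpq
  have := h.closed y z he
  simp only [Set.mem_ofPred_eq]
  rcases hpq with ⟨rfl, rfl⟩ | ⟨rfl, rfl⟩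
  · rw [contractFun_mem hxu hK, contractFun_mem hxu hK, this]
  · rw [contractFun_mem hxu hK, contractFun_mem hxu hK, this]

/-- If `z` is suppressed after deleting `zo`, then it can be suppressed keeping the
constraint disconnected. -/
def GoodAt {V : Type*} (G : SimpleGraph V) (z o : V) (K : Set V) (a b c d : V) : Prop :=
  SmallAt G z o → ∃ x, G.Adj z x ∧ x ≠ o ∧ (x ∈ K ↔ z ∈ K) ∧ s(z, x) ≠ s(a, b) ∧ s(z, x) ≠ s(c, d)

theorem suppress_nbr {V : Type*} {G : SimpleGraph V} {u v x : V} (hs : SmallAt G u v)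
    (hx : G.Adj u x) (hxv : x ≠ v) :
    (G.deleteEdges {s(u, v)}).Adj u x ∧
      ∃ x', ∀ t, (G.deleteEdges {s(u, v)}).Adj u t → t = x ∨ t = x' := by
  refine ⟨?_, ?_⟩
  · rw [deleteEdges_adj]
    refine ⟨hx, ?_⟩
    simp only [Set.mem_singleton_iff, Sym2.eq_iff]
    rintro (⟨-, h⟩ | ⟨h1, h2⟩)
    · exact hxv h
    · exact hx.ne h2.symm
  · obtain ⟨p, q, hpq⟩ := hs
    have key : ∀ t, (G.deleteEdges {s(u, v)}).Adj u t → t = p ∨ t = q := by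
      intro t ht
      rw [deleteEdges_adj] at ht
      rcases hpq t ht.1 with rfl | h
      · exact absurd rfl ht.2
      · exact h
    rcases hpq x hx with h | rfl | rfl
    · contradiction
    · exact ⟨q, key⟩
    · exact ⟨p, fun t ht => (key t ht).symm⟩

theorem one_small (C : CGraph) (h3 : KConnected 3 C.G) (hc : 4 < Nat.card C.V) {u v w : C.V}
    (huv : C.G.Adj u v) (hb : ¬ BadMinor (C.deleteEdge s(u, v)))
    {P Q : Set C.V} (hs : Sep3 C.G u v w P Q) (hu : SmallAt C.G u v) (hv : ¬ SmallAt C.G v u)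
    {K : Set C.V} {a b c d : C.V} (hK : Disc C.X K a b c d) (hg : GoodAt C.G u v K a b c d) :
    False := by
  obtain ⟨x, hx, hxv, hxK, hx1, hx2⟩ := hg hu
  obtain ⟨hadj, x', hx'⟩ := suppress_nbr hu hx hxv
  rw [kconn_iff] at h3
  have hns := nosep_delete h3.2 huv.ne hs
  have hns2 := nosep_contract hadj.ne' hx' hadj hns
  apply hb
  refine ⟨(C.deleteEdge s(u, v)).contract x u hadj.ne',
    Relation.ReflTransGen.single (CMinorStep.contr (C.deleteEdge s(u, v)) x u hadj.symm), ?_, ?_⟩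
  · refine (kconn_iff _).2 ⟨?_, ?_⟩
    · have := card_contract u
      change 3 < Nat.card {w : C.V // w ≠ u}
      omega
    · refine nosep_empty hns2 ?_
      rintro ⟨z, hz⟩ (⟨h, _⟩ | ⟨_, h⟩)
      · exact hz h
      · exact hv h
  · exact (hK.contract hadj.ne' hxK hx1 hx2).not_conn

theorem both_small (C : CGraph) (h3 : KConnected 3 C.G) {u v w : C.V}
    (huv : C.G.Adj u v) (hX : s(u, v) ∉ C.X) (hb : ¬ BadMinor (C.deleteEdge s(u, v)))
    {P Q : Set C.V} (hs : Sep3 C.G u v w P Q) (hu : SmallAt C.G u v) (hv : SmallAt C.G v u)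
    {K : Set C.V} {a b c d : C.V} (hK : Disc C.X K a b c d) (hgu : GoodAt C.G u v K a b c d)
    (hgv : GoodAt C.G v u K a b c d) :
    False := by
  obtain ⟨x, hx, hxv, hxK, hx1, hx2⟩ := hgu hu
  obtain ⟨y, hy, hyu, hyK, hy1, hy2⟩ := hgv hv
  obtain ⟨hadj, x', hx'⟩ := suppress_nbr hu hx hxv
  obtain ⟨hadj2, y', hy'⟩ := suppress_nbr hv hy hyu
  rw [Sym2.eq_swap] at hadj2 hy'
  rw [kconn_iff] at h3
  have hns := nosep_delete h3.2 huv.ne hs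
  have hns2 := nosep_contract hadj.ne' hx' hadj hns
  have hvu : v ≠ u := huv.ne'
  have hA : (contractGraph (C.G.deleteEdges {s(u, v)}) hadj.ne').Adj ⟨v, hvu⟩ ⟨y, hyu⟩ :=
    contract_adj_of _ hvu hyu hadj2
  have hN : ∃ z', ∀ t, (contractGraph (C.G.deleteEdges {s(u, v)}) hadj.ne').Adj ⟨v, hvu⟩ t →
      t = ⟨y, hyu⟩ ∨ t = z' := by
    refine ⟨contractFun hadj.ne' y', ?_⟩
    intro t ht
    rw [contract_adj] at ht
    obtain ⟨-, p, q, hpq, hp, rfl⟩ := ht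
    have hpv : p = v := by
      by_cases hpu : p = u
      · subst hpu
        rw [contractFun_self] at hp
        simp at hp
        contradiction
      · rw [contractFun_ne _ hpu] at hp
        simpa using hp
    subst hpv
    rcases hy' q hpq with rfl | rfl
    · left
      rw [contractFun_ne]
    · right; rfl
  obtain ⟨z', hz'⟩ := hN
  have hns3 := nosep_contract hA.ne' hz' hA hns2
  have hcard := card_six h3.1 h3.2 huv.ne hs hu hv
  apply hb
  refine ⟨((C.deleteEdge s(u, v)).contract x u hadj.ne').contract ⟨y, hyu⟩ ⟨v, hvu⟩ hA.ne', ?_, ?_, ?_⟩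
  · refine (Relation.ReflTransGen.single
      (CMinorStep.contr (C.deleteEdge s(u, v)) x u hadj.symm)).tail ?_
    exact CMinorStep.contr ((C.deleteEdge s(u, v)).contract x u hadj.ne') ⟨y, hyu⟩ ⟨v, hvu⟩ hA.symm
  · refine (kconn_iff _).2 ⟨?_, ?_⟩
    · have e1 := card_contract u
      have e2 := card_contract (⟨v, hvu⟩ : {w : C.V // w ≠ u})
      change 3 < Nat.card {w : {w : C.V // w ≠ u} // w ≠ ⟨v, hvu⟩}
      omega
    · refine nosep_empty hns3 ?_
      rintro ⟨⟨z, hz⟩, hz2⟩ (⟨h, _⟩ | ⟨h, _⟩)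
      · exact hz h
      · exact hz2 (Subtype.ext h)
  · have hK' := hK.contract hadj.ne' hxK hx1 hx2
    have key : ∀ p q, p ≠ q → s(p, q) ∈ C.X → s(v, y) ≠ s(p, q) →
        s((⟨v, hvu⟩ : {w : C.V // w ≠ u}), ⟨y, hyu⟩) ≠
          s(contractFun hadj.ne' p, contractFun hadj.ne' q) := by
      have main : ∀ p q, s(p, q) ∈ C.X → s(v, y) ≠ s(p, q) →
          (⟨v, hvu⟩ : {w : C.V // w ≠ u}) = contractFun hadj.ne' p →
          (⟨y, hyu⟩ : {w : C.V // w ≠ u}) = contractFun hadj.ne' q → False := by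
        intro p q hpX hne h1 h2
        have hpv : p = v := by
          by_cases hpu : p = u
          · subst hpu
            rw [contractFun_self] at h1
            simp at h1
            exact absurd h1.symm hxv
          · rw [contractFun_ne _ hpu] at h1
            simpa using h1.symm
        subst hpv
        by_cases hqu : q = u
        · subst hqu
          rw [Sym2.eq_swap] at hpX
          exact hX hpX
        · rw [contractFun_ne _ hqu] at h2
          simp at h2
          subst h2
          exact hne rfl
      intro p q _ hpX hne heq
      rw [Sym2.eq_iff] at heq
      rcases heq with ⟨h1, h2⟩ | ⟨h1, h2⟩
      · exact main p q hpX hne h1 h2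
      · rw [Sym2.eq_swap] at hpX
        rw [Sym2.eq_swap (a := p)] at hne
        exact main q p hpX hne h1 h2
    exact (hK'.contract hA.ne' hyK (key a b hK.ab hK.hab hy1) (key c d hK.cd hK.hcd hy2)).not_conn

theorem key_lemma (C : CGraph) (h3 : KConnected 3 C.G) (hc : 4 < Nat.card C.V) {u v : C.V}
    (huv : C.G.Adj u v) (hX : s(u, v) ∉ C.X) (he : Essential C s(u, v))
    {K₁ : Set C.V} {a₁ b₁ c₁ d₁ : C.V} (hK₁ : Disc C.X K₁ a₁ b₁ c₁ d₁) (h₁ : u ∈ K₁ ↔ v ∈ K₁) :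
    (∃ w P Q, Sep3 C.G u v w P Q) ∧
    ∀ (K : Set C.V) (a b c d : C.V), Disc C.X K a b c d → GoodAt C.G u v K a b c d →
      GoodAt C.G v u K a b c d → False := by
  obtain ⟨hdel, hcon⟩ := he
  have hsep : ∃ w P Q, Sep3 C.G u v w P Q := by
    refine exists_separator hc ((kconn_iff _).1 h3).2 huv.ne ?_
    intro hk
    refine hcon u v huv rfl ⟨_, Relation.ReflTransGen.refl, hk, ?_⟩
    refine (hK₁.contract huv.ne h₁ ?_ ?_).not_conn
    · intro h
      apply hX
      rw [Sym2.eq_swap, h]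
      exact hK₁.hab
    · intro h
      apply hX
      rw [Sym2.eq_swap, h]
      exact hK₁.hcd
  refine ⟨hsep, ?_⟩
  obtain ⟨w, P, Q, hs⟩ := hsep
  intro K a b c d hK hgu hgv
  by_cases hu : SmallAt C.G u v
  · by_cases hv : SmallAt C.G v u
    · exact both_small C h3 huv hX hdel hs hu hv hK hgu hgv
    · exact one_small C h3 hc huv hdel hs hu hv hK hgu
  · by_cases hv : SmallAt C.G v u
    · rw [Sym2.eq_swap] at hdel
      exact one_small C h3 hc huv.symm hdel hs.swap hv hu hK hgv
    · apply hdel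
      refine ⟨_, Relation.ReflTransGen.refl, ?_, hK.not_conn⟩
      rw [kconn_iff] at h3
      refine (kconn_iff _).2 ⟨h3.1, ?_⟩
      refine nosep_empty (nosep_delete h3.2 huv.ne hs) ?_
      rintro z (⟨_, h⟩ | ⟨_, h⟩)
      · exact hu h
      · exact hv h

end constraintPart

section uncovered

theorem Disc.modify {V : Type*} {X : Set (Sym2 V)} {K : Set V} {a b c d : V}
    (h : Disc X K a b c d) {u : V} (hu : u ∉ (fromEdgeSet X).support) (r : Prop) :
    Disc X {z | (z = u ∧ r) ∨ (z ≠ u ∧ z ∈ K)} a b c d := by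
  have hne : ∀ p q, s(p, q) ∈ X → p ≠ q → p ≠ u := by
    rintro p q hpq hne rfl
    exact hu (mem_supp.2 ⟨q, hpq, hne⟩)
  refine ⟨?_, h.ab, h.hab, Or.inr ⟨hne _ _ h.hab h.ab, h.ha⟩, h.cd, h.hcd, ?_⟩
  · intro p q hpq
    by_cases hp : p = q
    · rw [hp]
    · have h1 := hne p q hpq hp
      have h2 := hne q p (by rwa [Sym2.eq_swap]) (Ne.symm hp)
      have := h.closed p q hpq
      simp only [Set.mem_ofPred_eq, h1, h2, this]
      tauto
  · rintro (⟨hc, -⟩ | ⟨-, hc⟩)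
    · exact hne _ _ h.hcd h.cd hc
    · exact h.hc hc

theorem small_three {V : Type*} {G : SimpleGraph V} {z o x y t : V} (h : SmallAt G z o)
    (hx : G.Adj z x) (hy : G.Adj z y) (ht : G.Adj z t) (hxo : x ≠ o) (hyo : y ≠ o) (hto : t ≠ o) :
    x = y ∨ x = t ∨ y = t := by
  obtain ⟨p, q, hpq⟩ := h
  have h1 := hpq x hx
  have h2 := hpq y hy
  have h3 := hpq t ht
  grind

/-- consequences of `GoodAt` failing -/
theorem not_good {V : Type*} {G : SimpleGraph V} {z o : V} {K : Set V} {a b c d : V}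
    (h : ¬ GoodAt G z o K a b c d) : SmallAt G z o ∧
      ∀ y, G.Adj z y → y ≠ o → (y ∈ K ↔ z ∈ K) → s(z, y) = s(a, b) ∨ s(z, y) = s(c, d) := by
  unfold GoodAt at h
  push Not at h
  refine ⟨h.1, fun y h1 h2 h3 => ?_⟩
  have := h.2 y h1 h2 h3
  tauto

theorem uncovered_hyp (C : CGraph) (h3 : KConnected 3 C.G) (hc : 4 < Nat.card C.V)
    (hess : ∀ e ∈ C.G.edgeSet, e ∉ C.X → Essential C e) {u v : C.V}
    (hu : u ∉ (fromEdgeSet C.X).support) (huv : C.G.Adj u v) {K : Set C.V} {a b c d : C.V}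
    (hK : Disc C.X K a b c d) : ¬ GoodAt C.G v u K a b c d := by
  intro hg
  have hnX : ∀ x, C.G.Adj u x → s(u, x) ∉ C.X := fun x hx hX => hu (mem_supp.2 ⟨x, hX, hx.ne⟩)
  obtain ⟨x, hx, hxv, -⟩ := exists_nbr (by omega) ((kconn_iff _).1 h3).2 u v v
  have hvu := huv.ne'
  have hxu := hx.ne'
  refine (key_lemma C h3 hc huv (hnX v huv) (hess _ huv (hnX v huv)) (hK.modify hu (v ∈ K)) ?_).2
    _ a b c d (hK.modify hu (x ∈ K)) ?_ ?_
  · simp [hvu]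
  · intro _
    refine ⟨x, hx, hxv, ?_, ?_, ?_⟩
    · simp [hxu]
    · intro h
      apply hnX x hx
      rw [h]
      exact hK.hab
    · intro h
      apply hnX x hx
      rw [h]
      exact hK.hcd
  · intro hs
    obtain ⟨y, hy, hyu, hyK, h1, h2⟩ := hg hs
    exact ⟨y, hy, hyu, by simp [hyu, hvu, hyK], h1, h2⟩

theorem uncovered_nbr {V : Type*} [Finite V] {G : SimpleGraph V} {X : Set (Sym2 V)}
    (hW : ∀ p q, s(p, q) ∈ X → G.Adj p q) (hc : 3 < Nat.card V) (hN : NoSep ∅ G)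
    {K : Set V} {a b c d : V} (hK : Disc X K a b c d) {u v : V}
    (hu : u ∉ (fromEdgeSet X).support) (huv : G.Adj u v)
    (H : ∀ K a b c d, Disc X K a b c d → ¬ GoodAt G v u K a b c d) :
    SmallAt G v u ∧ ∃ v', s(v, v') ∈ X ∧
      (∀ K a b c d, Disc X K a b c d → v ∈ K → ∀ p q, s(p, q) ∈ X → p ∈ K →
        s(p, q) = s(v, v')) ∧
      (∃ c d, Disc X {v, v'} v v' c d) ∧
      ∀ y, G.Adj v y → y ≠ u → y ∈ (fromEdgeSet X).support := by
  have hS : ∀ p q, s(p, q) ∈ X → p ∈ (fromEdgeSet X).support := fun p q h =>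
    mem_supp.2 ⟨q, h, (hW p q h).ne⟩
  have hsm := (not_good (H K a b c d hK)).1
  refine ⟨hsm, ?_⟩
  have hv : v ∈ (fromEdgeSet X).support := by
    by_contra hv
    obtain ⟨y, hy, hyu, -⟩ := exists_nbr hc hN v u u
    have hyv := hy.ne'
    have hK' := hK.modify hv (y ∈ K)
    rcases (not_good (H _ a b c d hK')).2 y hy hyu (by simp [hyv]) with h | h
    · apply hv
      refine hS v y ?_
      rw [h]
      exact hK.hab
    · apply hv
      refine hS v y ?_
      rw [h]
      exact hK.hcd
  obtain ⟨v', hX, hne⟩ := mem_supp.1 hv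
  have hv'u : v' ≠ u := by
    rintro rfl
    apply hu
    refine hS v' v ?_
    rwa [Sym2.eq_swap]
  have key : ∀ K a b c d, Disc X K a b c d → v ∈ K → ∀ p q, s(p, q) ∈ X → p ∈ K →
        s(p, q) = s(v, v') := by
    intro K a b c d hK hvK p q hpq hp
    have hK' : Disc X K p q c d :=
      ⟨hK.closed, (hW p q hpq).ne, hpq, hp, hK.cd, hK.hcd, hK.hc⟩
    rcases (not_good (H K p q c d hK')).2 v' (hW _ _ hX) hv'u (hK.closed _ _ hX).symm with h | h
    · exact h.symm
    · exfalso
      rw [Sym2.eq_iff] at h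
      have h2 := hK.hc
      have h4 := (hK.closed _ _ hX).1 hvK
      rcases h with ⟨h, -⟩ | ⟨-, h⟩
      · rw [h] at hvK; contradiction
      · rw [h] at h4; contradiction
  have hD : ∃ K a b c d, Disc X K a b c d ∧ v ∈ K := by
    by_cases hvK : v ∈ K
    · exact ⟨K, a, b, c, d, hK, hvK⟩
    · exact ⟨_, _, _, _, _, hK.compl, hvK⟩
  obtain ⟨K, a, b, c, d, hK, hvK⟩ := hD
  have k1 := key K a b c d hK hvK
  have hv'K := (hK.closed _ _ hX).1 hvK
  have c1 : ∀ p q, s(p, q) ∈ X → p = v ∨ p = v' → q = v ∨ q = v' := by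
    rintro p q hpq hp
    have : p ∈ K := by rcases hp with rfl | rfl <;> assumption
    have := k1 p q hpq this
    rw [Sym2.eq_iff] at this
    rcases this with h | h <;> simp [h]
  have c2 : ∀ p q, s(p, q) ∈ X → (p = v ∨ p = v' ↔ q = v ∨ q = v') := fun p q h =>
    ⟨c1 p q h, c1 q p (by rwa [Sym2.eq_swap])⟩
  have hcv : ¬ (c = v ∨ c = v') := by
    have := hK.hc
    rintro (rfl | rfl) <;> contradiction
  refine ⟨v', hX, key, ⟨c, d, ⟨fun p q h => by simpa using c2 p q h, hne, hX, by simp, hK.cd, hK.hcd,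
    by simpa using hcv⟩⟩, ?_⟩
  intro y hy hyu
  by_contra hyS
  have hK' : Disc X {z | (z = v ∨ z = v') ∨ z ∉ (fromEdgeSet X).support} v v' c d := by
    refine ⟨fun p q h => ?_, hne, hX, by simp, hK.cd, hK.hcd, ?_⟩
    · have e1 := hS p q h
      have e2 := hS q p (by rwa [Sym2.eq_swap])
      simp only [Set.mem_ofPred_eq, e1, e2, c2 p q h]
    · have e1 := hS c d hK.hcd
      simp only [Set.mem_ofPred_eq, e1, hcv]
      simp
  rcases (not_good (H _ _ _ _ _ hK')).2 y hy hyu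
    (iff_of_true (Or.inr hyS) (Or.inl (Or.inl rfl))) with h | h
  · apply hyS
    apply hS y v
    rw [Sym2.eq_swap, h]
    exact hX
  · apply hyS
    apply hS y v
    rw [Sym2.eq_swap, h]
    exact hK.hcd

theorem iso_of {C D : CGraph} (f : D.V → C.V) (hf : Function.Bijective f)
    (hadj : ∀ i j, C.G.Adj (f i) (f j) ↔ D.G.Adj i j)
    (hX : ∀ i j, s(f i, f j) ∈ C.X ↔ s(i, j) ∈ D.X) : CGIso C D := by
  let φ := Equiv.ofBijective f hf
  have hφ : ∀ i, f (φ.symm i) = i := fun i => φ.apply_symm_apply i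
  have hφ2 : ∀ i, φ.symm (f i) = i := fun i => φ.symm_apply_apply i
  refine ⟨⟨φ.symm, ?_⟩, ?_⟩
  · intro a b
    rw [← hadj, hφ, hφ]
  · ext e
    constructor
    · rintro ⟨e, he, rfl⟩
      induction e with | _ y z
      change s(φ.symm y, φ.symm z) ∈ D.X
      rw [← hX, hφ, hφ]
      exact he
    · intro he
      induction e with | _ y z
      refine ⟨s(f y, f z), (hX y z).2 he, ?_⟩
      change s(φ.symm (f y), φ.symm (f z)) = _
      rw [hφ2, hφ2]

end uncovered

section wheel

theorem wheel_iso (C : CGraph) {u a a' b b' : C.V} (hall : ∀ z, z = u ∨ z = a ∨ z = a' ∨ z = b ∨ z = b')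
    (hX : ∀ p q, s(p, q) ∈ C.X ↔ s(p, q) = s(a, a') ∨ s(p, q) = s(b, b'))
    (hd : a ≠ a' ∧ a ≠ b ∧ a ≠ b' ∧ a' ≠ b ∧ a' ≠ b' ∧ b ≠ b' ∧ u ≠ a ∧ u ≠ a' ∧ u ≠ b ∧ u ≠ b')
    (h1 : C.G.Adj a a') (h2 : C.G.Adj b b') (h3 : C.G.Adj a b) (h4 : C.G.Adj a' b')
    (h5 : ¬ C.G.Adj a b') (h6 : ¬ C.G.Adj a' b)
    (k1 : C.G.Adj u a) (k2 : C.G.Adj u a') (k3 : C.G.Adj u b) (k4 : C.G.Adj u b') :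
    CGIso C constraintWheel := by
  obtain ⟨d1, d2, d3, d4, d5, d6, d7, d8, d9, d10⟩ := hd
  let f : Fin 5 → C.V := ![a, a', b', b, u]
  refine iso_of (D := constraintWheel) f ⟨?_, ?_⟩ ?_ ?_
  · have : ∀ i j : Fin 5, f i = f j → i = j := by
      intro i j
      fin_cases i <;> fin_cases j <;>
        simp [f, d1, d2, d3, d4, d5, d6, d7, d8, d9, d10, d1.symm, d2.symm, d3.symm, d4.symm,
          d5.symm, d6.symm, d7.symm, d8.symm, d9.symm, d10.symm]
    exact this
  · intro z
    rcases hall z with rfl | rfl | rfl | rfl | rfl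
    · exact ⟨(4 : Fin 5), rfl⟩
    · exact ⟨(0 : Fin 5), rfl⟩
    · exact ⟨(1 : Fin 5), rfl⟩
    · exact ⟨(3 : Fin 5), rfl⟩
    · exact ⟨(2 : Fin 5), rfl⟩
  · have h5' : ¬ C.G.Adj b' a := fun h => h5 h.symm
    have h6' : ¬ C.G.Adj b a' := fun h => h6 h.symm
    have : ∀ i j : Fin 5, C.G.Adj (f i) (f j) ↔ wheelGraph.Adj i j := by
      intro i j
      unfold wheelGraph
      fin_cases i <;> fin_cases j <;>
        simp [f, h1, h2, h3, h4, h5, h6, k1, k2, k3, k4, h1.symm, h2.symm, h3.symm, h4.symm,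
          h5', h6', k1.symm, k2.symm, k3.symm, k4.symm]
    exact this
  · have : ∀ i j : Fin 5, s(f i, f j) ∈ C.X ↔ s(i, j) ∈ ({s(0, 1), s(2, 3)} : Set (Sym2 (Fin 5))) := by
      intro i j
      rw [hX]
      fin_cases i <;> fin_cases j <;>
        simp [f, d1, d2, d3, d4, d5, d6, d7, d8, d9, d10, d1.symm, d2.symm, d3.symm, d4.symm,
          d5.symm, d6.symm, d7.symm, d8.symm, d9.symm, d10.symm]
    exact this

theorem wheel_of {C : CGraph} (hW : ∀ p q, s(p, q) ∈ C.X → C.G.Adj p q)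
    (hc : 3 < Nat.card C.V) (hN : NoSep ∅ C.G) {u a a' b b' : C.V}
    (hall : ∀ z, z = u ∨ z = a ∨ z = a' ∨ z = b ∨ z = b')
    (hX : ∀ p q, s(p, q) ∈ C.X ↔ s(p, q) = s(a, a') ∨ s(p, q) = s(b, b'))
    (hd : a ≠ a' ∧ a ≠ b ∧ a ≠ b' ∧ a' ≠ b ∧ a' ≠ b' ∧ b ≠ b' ∧ u ≠ a ∧ u ≠ a' ∧ u ≠ b ∧ u ≠ b')
    (k1 : C.G.Adj u a) (k2 : C.G.Adj u a') (k3 : C.G.Adj u b) (s1 : SmallAt C.G a u)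
    (s2 : SmallAt C.G a' u) (h3 : C.G.Adj a b) (h6 : ¬ C.G.Adj a' b) :
    CGIso C constraintWheel := by
  have h1 : C.G.Adj a a' := hW _ _ ((hX _ _).2 (Or.inl rfl))
  have h2 : C.G.Adj b b' := hW _ _ ((hX _ _).2 (Or.inr rfl))
  have h5 : ¬ C.G.Adj a b' := by
    intro h
    have := small_three s1 h1 h3 h (by grind) (by grind) (by grind)
    grind
  have h4 : C.G.Adj a' b' := by
    obtain ⟨x, hx, hx1, hx2⟩ := exists_nbr hc hN a' a u
    have := hall x
    have := hx.ne
    grind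
  have k4 : C.G.Adj u b' := by
    obtain ⟨x, hx, hx1, hx2⟩ := exists_nbr hc hN b' a' b
    have := hall x
    have := hx.ne
    have := hx.symm
    grind
  exact wheel_iso C hall hX hd h1 h2 h3 h4 h5 h6 k1 k2 k3 k4

theorem wheel_of2 {C : CGraph} (hW : ∀ p q, s(p, q) ∈ C.X → C.G.Adj p q)
    (hc : 3 < Nat.card C.V) (hN : NoSep ∅ C.G) {u a a' b b' : C.V}
    (hall : ∀ z, z = u ∨ z = a ∨ z = a' ∨ z = b ∨ z = b')
    (hX : ∀ p q, s(p, q) ∈ C.X ↔ s(p, q) = s(a, a') ∨ s(p, q) = s(b, b'))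
    (hd : a ≠ a' ∧ a ≠ b ∧ a ≠ b' ∧ a' ≠ b ∧ a' ≠ b' ∧ b ≠ b' ∧ u ≠ a ∧ u ≠ a' ∧ u ≠ b ∧ u ≠ b')
    (k1 : C.G.Adj u a) (k2 : C.G.Adj u a') (k3 : C.G.Adj u b) (s1 : SmallAt C.G a u)
    (s2 : SmallAt C.G a' u) (s3 : SmallAt C.G b u) : CGIso C constraintWheel := by
  have h2 : C.G.Adj b b' := hW _ _ ((hX _ _).2 (Or.inr rfl))
  obtain ⟨x, hx, hx1, hx2⟩ := exists_nbr hc hN b b' u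
  have hxx : x = a ∨ x = a' := by
    have := hall x
    have := hx.ne
    grind
  have key : ¬ (C.G.Adj b a ∧ C.G.Adj b a') := by
    rintro ⟨e1, e2⟩
    have := small_three s3 h2 e1 e2 (by grind) (by grind) (by grind)
    grind
  rcases hxx with rfl | rfl
  · exact wheel_of hW hc hN hall hX hd k1 k2 k3 s1 s2 hx.symm (fun h => key ⟨hx, h.symm⟩)
  · refine wheel_of hW hc hN (a := x) (a' := a) (b := b) (b' := b') (u := u) ?_ ?_ ?_ k2 k1 k3 s2 s1
      hx.symm (fun h => key ⟨h.symm, hx⟩)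
    · intro z
      have := hall z
      tauto
    · intro p q
      rw [hX, Sym2.eq_swap (a := x)]
    · clear hall hX
      grind

theorem uncovered_wheel (C : CGraph) (hWF : C.WF) (h3 : KConnected 3 C.G)
    (hdisc : ¬ EdgeSetConnected C.X)
    (hess : ∀ e ∈ C.G.edgeSet, e ∉ C.X → Essential C e) {u : C.V}
    (hu : u ∉ (fromEdgeSet C.X).support) : CGIso C constraintWheel := by
  have hW : ∀ p q, s(p, q) ∈ C.X → C.G.Adj p q := fun p q h => hWF h
  obtain ⟨K, a₀, b₀, c₀, d₀, hK⟩ := exists_disc hdisc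
  have hk := (kconn_iff _).1 h3
  have hS : ∀ p q, s(p, q) ∈ C.X → p ∈ (fromEdgeSet C.X).support := fun p q h =>
    mem_supp.2 ⟨q, h, (hW p q h).ne⟩
  have hS2 : ∀ p q, s(p, q) ∈ C.X → q ∈ (fromEdgeSet C.X).support := fun p q h =>
    hS q p (by rwa [Sym2.eq_swap])
  have hcard : 4 < Nat.card C.V := by
    have hne := hK.ne
    have hu1 : u ≠ a₀ := by rintro rfl; exact hu (hS _ _ hK.hab)
    have hu2 : u ≠ b₀ := by rintro rfl; exact hu (hS2 _ _ hK.hab)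
    have hu3 : u ≠ c₀ := by rintro rfl; exact hu (hS _ _ hK.hcd)
    have hu4 : u ≠ d₀ := by rintro rfl; exact hu (hS2 _ _ hK.hcd)
    have := hK.ab
    have := hK.cd
    classical
    have h5 : ({u, a₀, b₀, c₀, d₀} : Finset C.V).card = 5 := by
      repeat rw [Finset.card_insert_of_notMem (by simp; grind)]
      simp
    haveI := Fintype.ofFinite C.V
    have := Finset.card_le_univ ({u, a₀, b₀, c₀, d₀} : Finset C.V)
    rw [Nat.card_eq_fintype_card]
    omega
  have N : ∀ z v, z ∉ (fromEdgeSet C.X).support → C.G.Adj z v → _ := fun z v hz hzv =>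
    uncovered_nbr hW hk.1 hk.2 hK hz hzv
      (fun K a b c d hK => uncovered_hyp C h3 hcard hess hz hzv hK)
  have main : ∀ a a' b b', s(a, a') ∈ C.X → s(b, b') ∈ C.X →
      (∀ p q, s(p, q) ∈ C.X → s(p, q) = s(a, a') ∨ s(p, q) = s(b, b')) → a ≠ b → a ≠ b' →
      C.G.Adj u a → C.G.Adj u a' → C.G.Adj u b → CGIso C constraintWheel := by
    intro a a' b b' haX hbX hX hab hab' k1 k2 k3
    obtain ⟨s1, _, _, -, -, m1⟩ := N u a hu k1
    obtain ⟨s2, _, _, -, -, m2⟩ := N u a' hu k2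
    obtain ⟨s3, _, _, -, -, m3⟩ := N u b hu k3
    have hSX : ∀ y, y ∈ (fromEdgeSet C.X).support → y = a ∨ y = a' ∨ y = b ∨ y = b' := by
      intro y hy
      obtain ⟨q, hq, -⟩ := mem_supp.1 hy
      have := hX _ _ hq
      simp only [Sym2.eq_iff] at this
      grind
    have hab2 : a' ≠ b ∧ a' ≠ b' := by
      obtain ⟨hcl, d1, d2, d3, d4, d5, d6⟩ := hK
      have q1 := hX _ _ d2
      have q2 := hX _ _ d5
      have q3 := hcl _ _ haX
      have q4 := hcl _ _ hbX
      simp only [Sym2.eq_iff] at q1 q2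
      constructor
      · rintro rfl
        grind
      · rintro rfl
        grind
    refine wheel_of2 hW hk.1 hk.2 (u := u) (a := a) (a' := a') (b := b) (b' := b') ?_ ?_ ?_ k1 k2 k3
      s1 s2 s3
    · intro z
      by_cases hz : z ∈ (fromEdgeSet C.X).support
      · exact Or.inr (hSX z hz)
      · left
        obtain ⟨y, hy, hyb, -⟩ := exists_nbr hk.1 hk.2 z b' b'
        have hyS : y ∈ (fromEdgeSet C.X).support := by
          obtain ⟨_, v', e1, -⟩ := N z y hz hy
          exact hS _ _ e1
        by_contra hzu
        rcases hSX y hyS with rfl | rfl | rfl | rfl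
        · exact hz (m1 z hy.symm hzu)
        · exact hz (m2 z hy.symm hzu)
        · exact hz (m3 z hy.symm hzu)
        · exact hyb rfl
    · intro p q
      refine ⟨hX p q, ?_⟩
      rintro (h | h) <;> rw [h] <;> assumption
    · have e1 := (hW _ _ haX).ne
      have e2 := (hW _ _ hbX).ne
      have e3 := hS2 _ _ hbX
      have : u ≠ b' := by rintro rfl; contradiction
      exact ⟨e1, hab, hab', hab2.1, hab2.2, e2, k1.ne, k2.ne, k3.ne, this⟩
  obtain ⟨a, ha, -⟩ := exists_nbr hk.1 hk.2 u u u
  obtain ⟨-, a', haX, ha1, ⟨c, d, hKa⟩, -⟩ := N u a hu ha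
  obtain ⟨b, hb, hba, hba'⟩ := exists_nbr hk.1 hk.2 u a a'
  obtain ⟨-, b', hbX, hb1, -, -⟩ := N u b hu hb
  have hX : ∀ p q, s(p, q) ∈ C.X → s(p, q) = s(a, a') ∨ s(p, q) = s(b, b') := by
    intro p q hpq
    by_cases hp : p ∈ ({a, a'} : Set C.V)
    · exact Or.inl (ha1 _ _ _ _ _ hKa (by simp) p q hpq hp)
    · exact Or.inr (hb1 _ _ _ _ _ hKa.compl (by simp [hba, hba']) p q hpq hp)
  have hb' : b' ≠ a ∧ b' ≠ a' := by
    have := hKa.closed _ _ hbX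
    simp [hba, hba'] at this
    exact this
  obtain ⟨c, hc, hca, hcb⟩ := exists_nbr hk.1 hk.2 u a b
  obtain ⟨-, c', hcX, -⟩ := N u c hu hc
  have := hX _ _ hcX
  simp only [Sym2.eq_iff] at this
  have hcc : c = a' ∨ c = b' := by grind
  rcases hcc with rfl | rfl
  · exact main a c b b' haX hbX hX hba.symm hb'.1.symm ha hc hb
  · exact main b c a a' hbX haX (fun p q h => (hX p q h).symm) hba hba' hb hc ha

end wheel

section threeComponents

/-- Everything is covered, and a three component situation: consequences for one edge. -/
theorem three_hyp (C : CGraph) (hWF : C.WF) (h3 : KConnected 3 C.G) (hc : 4 < Nat.card C.V)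
    (hess : ∀ e ∈ C.G.edgeSet, e ∉ C.X → Essential C e)
    (hm : ∀ z, ∃ z', s(z, z') ∈ C.X)
    (hthree : ∀ u v, ∃ w, ¬ (fromEdgeSet C.X).Reachable u w ∧ ¬ (fromEdgeSet C.X).Reachable v w)
    {u v : C.V} (huv : C.G.Adj u v) (hX : s(u, v) ∉ C.X) :
    (∃ w P Q, Sep3 C.G u v w P Q) ∧ ∀ (K : Set C.V) (a b c d : C.V), Disc C.X K a b c d →
      GoodAt C.G u v K a b c d → GoodAt C.G v u K a b c d → False := by
  obtain ⟨w, hw1, hw2⟩ := hthree u v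
  obtain ⟨u', hu'⟩ := hm u
  obtain ⟨w', hw'⟩ := hm w
  have hD : Disc C.X {z | (fromEdgeSet C.X).Reachable u z ∨ (fromEdgeSet C.X).Reachable v z}
      u u' w w' := by
    refine ⟨fun p q h => ?_, (hWF hu' : C.G.Adj _ _).ne, hu', Or.inl (Reachable.refl _),
      (hWF hw' : C.G.Adj _ _).ne, hw', ?_⟩
    · simp only [Set.mem_ofPred_eq]
      rw [reach_closed C.X u p q h, reach_closed C.X v p q h]
    · rintro (h | h) <;> contradiction
  exact key_lemma C h3 hc huv hX (hess _ huv hX) hD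
    (iff_of_true (Or.inl (Reachable.refl _)) (Or.inr (Reachable.refl _)))

theorem reach_of {V : Type*} {X : Set (Sym2 V)} {p q : V} (h : s(p, q) ∈ X) :
    (fromEdgeSet X).Reachable p q :=
  (reach_closed X p p q h).1 (Reachable.refl _)

theorem reach_edge {V : Type*} {X : Set (Sym2 V)} {u u' x y : V} (hu : s(u, u') ∈ X)
    (h : s(u, u') = s(x, y)) : (fromEdgeSet X).Reachable u x := by
  rw [Sym2.eq_iff] at h
  rcases h with ⟨rfl, rfl⟩ | ⟨rfl, rfl⟩
  · exact Reachable.refl _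
  · exact reach_of hu

theorem three_edge {V : Type*} {G : SimpleGraph V} {X : Set (Sym2 V)}
    (hW : ∀ p q, s(p, q) ∈ X → G.Adj p q)
    (hm : ∀ z, ∃ z', s(z, z') ∈ X)
    (hthree : ∀ u v, ∃ w, ¬ (fromEdgeSet X).Reachable u w ∧ ¬ (fromEdgeSet X).Reachable v w)
    {u v : V} (hX : s(u, v) ∉ X)
    (H : ∀ (K : Set V) (a b c d : V), Disc X K a b c d →
      GoodAt G u v K a b c d → GoodAt G v u K a b c d → False) :
    SmallAt G u v ∧ ¬ (fromEdgeSet X).Reachable u v ∧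
    (∀ u' x y, s(u, u') ∈ X → s(x, y) ∈ X → (fromEdgeSet X).Reachable u x → s(u, u') = s(x, y)) ∧
    (∀ p q, ¬ (fromEdgeSet X).Reachable u p → ¬ (fromEdgeSet X).Reachable v p →
      ¬ (fromEdgeSet X).Reachable u q → ¬ (fromEdgeSet X).Reachable v q →
      (fromEdgeSet X).Reachable p q) ∧
    (∀ v', s(v, v') ∈ X → ¬ G.Adj u v') := by
  have hD : ∀ p a b c d, s(a, b) ∈ X → s(c, d) ∈ X → (fromEdgeSet X).Reachable p a →
      ¬ (fromEdgeSet X).Reachable p c → Disc X {z | (fromEdgeSet X).Reachable p z} a b c d :=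
    fun p a b c d h1 h2 h3 h4 =>
      ⟨fun x y h => reach_closed X p x y h, (hW _ _ h1).ne, h1, h3, (hW _ _ h2).ne, h2, h4⟩
  have F : ∀ K a b c d, Disc X K a b c d →
      (SmallAt G u v → ∃ u', s(u, u') ∈ X ∧ s(u, u') ≠ s(a, b) ∧ s(u, u') ≠ s(c, d)) →
      (SmallAt G v u → ∃ v', s(v, v') ∈ X ∧ s(v, v') ≠ s(a, b) ∧ s(v, v') ≠ s(c, d)) → False := by
    intro K a b c d hK h1 h2
    refine H K a b c d hK ?_ ?_
    · intro hs
      obtain ⟨u', e1, e2, e3⟩ := h1 hs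
      refine ⟨u', hW _ _ e1, ?_, (hK.closed _ _ e1).symm, e2, e3⟩
      rintro rfl
      exact hX e1
    · intro hs
      obtain ⟨u', e1, e2, e3⟩ := h2 hs
      refine ⟨u', hW _ _ e1, ?_, (hK.closed _ _ e1).symm, e2, e3⟩
      rintro rfl
      apply hX
      rwa [Sym2.eq_swap]
  obtain ⟨u₁, hu₁⟩ := hm u
  obtain ⟨v₁, hv₁⟩ := hm v
  have hout : ∀ p q, ¬ (fromEdgeSet X).Reachable v p → ¬ (fromEdgeSet X).Reachable v q →
      (SmallAt G u v → ¬ (fromEdgeSet X).Reachable u p ∧ ¬ (fromEdgeSet X).Reachable u q) →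
      (fromEdgeSet X).Reachable p q := by
    intro p q h1 h2 h3
    by_contra h4
    obtain ⟨p', hp'⟩ := hm p
    obtain ⟨q', hq'⟩ := hm q
    refine F _ p p' q q' (hD p p p' q q' hp' hq' (Reachable.refl _) h4) ?_ ?_
    · intro hs
      exact ⟨u₁, hu₁, fun h => (h3 hs).1 (reach_edge hu₁ h), fun h => (h3 hs).2 (reach_edge hu₁ h)⟩
    · intro _
      exact ⟨v₁, hv₁, fun h => h1 (reach_edge hv₁ h), fun h => h2 (reach_edge hv₁ h)⟩
  obtain ⟨p, hp, -⟩ := hthree v v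
  obtain ⟨q, hvq, hpq⟩ := hthree v p
  have hs : SmallAt G u v := by
    by_contra hs
    exact hpq (hout p q hp hvq (fun h => absurd h hs))
  have hR : ¬ (fromEdgeSet X).Reachable u v := by
    intro hR
    exact hpq (hout p q hp hvq (fun _ => ⟨fun h => hp (hR.symm.trans h),
      fun h => hvq (hR.symm.trans h)⟩))
  have hsing : ∀ u' x y, s(u, u') ∈ X → s(x, y) ∈ X → (fromEdgeSet X).Reachable u x →
      s(u, u') = s(x, y) := by
    intro u' x y h1 h2 h3
    by_contra hne
    obtain ⟨w, hw1, hw2⟩ := hthree u v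
    obtain ⟨w', hw'⟩ := hm w
    refine F _ x y w w' (hD u x y w w' h2 hw' h3 hw1) ?_ ?_
    · intro _
      exact ⟨u', h1, hne, fun h => hw1 (reach_edge h1 h)⟩
    · intro _
      exact ⟨v₁, hv₁, fun h => hR (h3.trans (reach_edge hv₁ h).symm), fun h => hw2 (reach_edge hv₁ h)⟩
  refine ⟨hs, hR, hsing, fun p q h1 h2 h3 h4 => hout p q h2 h4 (fun _ => ⟨h1, h3⟩), ?_⟩
  intro v' hv' hadj
  obtain ⟨w, hw1, hw2⟩ := hthree u v
  obtain ⟨w', hw'⟩ := hm w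
  have hvu : ¬ (fromEdgeSet X).Reachable v u := fun h => hR h.symm
  have hv'v := (hW _ _ hv').ne'
  have hv'u := hadj.ne'
  have hRv := reach_of hv'
  have hK : Disc X {z | (fromEdgeSet X).Reachable u z ∨ (fromEdgeSet X).Reachable v z}
      u u₁ w w' := by
    refine ⟨fun p q h => ?_, (hW _ _ hu₁).ne, hu₁, Or.inl (Reachable.refl _),
      (hW _ _ hw').ne, hw', ?_⟩
    · simp only [Set.mem_ofPred_eq]
      rw [reach_closed X u p q h, reach_closed X v p q h]
    · rintro (h | h) <;> contradiction
  refine H _ _ _ _ _ hK ?_ ?_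
  · intro _
    refine ⟨v', hadj, hv'v, iff_of_true (Or.inr hRv) (Or.inl (Reachable.refl _)), ?_, ?_⟩
    · intro h
      rw [Sym2.eq_iff] at h
      have := reach_of hu₁
      rcases h with ⟨-, rfl⟩ | ⟨-, h⟩
      · exact hR (this.trans hRv.symm)
      · exact hv'u h
    · intro h
      rw [Sym2.eq_iff] at h
      rcases h with ⟨rfl, -⟩ | ⟨-, rfl⟩
      · exact hw1 (Reachable.refl _)
      · exact hw2 hRv
  · intro _
    refine ⟨v', hW _ _ hv', hv'u, iff_of_true (Or.inr hRv) (Or.inr (Reachable.refl _)), ?_, ?_⟩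
    · intro h
      exact hvu (reach_edge hv' h)
    · intro h
      exact hw2 (reach_edge hv' h)

theorem prism_iso (C : CGraph) {u v w u' v' w' : C.V}
    (hall : ∀ z, z = u ∨ z = v ∨ z = w ∨ z = u' ∨ z = v' ∨ z = w')
    (hX : ∀ p q, s(p, q) ∈ C.X ↔ s(p, q) = s(u, u') ∨ s(p, q) = s(v, v') ∨ s(p, q) = s(w, w'))
    (hd : [u, v, w, u', v', w'].Nodup)
    (h1 : C.G.Adj u v) (h2 : C.G.Adj v w) (h3 : C.G.Adj u w)
    (h4 : C.G.Adj u' v') (h5 : C.G.Adj v' w') (h6 : C.G.Adj u' w')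
    (h7 : C.G.Adj u u') (h8 : C.G.Adj v v') (h9 : C.G.Adj w w')
    (n1 : ¬ C.G.Adj u v') (n2 : ¬ C.G.Adj u w') (n3 : ¬ C.G.Adj v u') (n4 : ¬ C.G.Adj v w')
    (n5 : ¬ C.G.Adj w u') (n6 : ¬ C.G.Adj w v') : CGIso C weirdPrism := by
  let f : Fin 6 → C.V := ![u, v, w, u', v', w']
  have hinj : Function.Injective f := by
    have : f = [u, v, w, u', v', w'].get := by
      ext i
      fin_cases i <;> rfl
    rw [this]
    exact List.nodup_iff_injective_get.1 hd
  refine iso_of (D := weirdPrism) f ⟨hinj, ?_⟩ ?_ ?_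
  · intro z
    rcases hall z with rfl | rfl | rfl | rfl | rfl | rfl
    · exact ⟨(0 : Fin 6), rfl⟩
    · exact ⟨(1 : Fin 6), rfl⟩
    · exact ⟨(2 : Fin 6), rfl⟩
    · exact ⟨(3 : Fin 6), rfl⟩
    · exact ⟨(4 : Fin 6), rfl⟩
    · exact ⟨(5 : Fin 6), rfl⟩
  · have n1' : ¬ C.G.Adj v' u := fun h => n1 h.symm
    have n2' : ¬ C.G.Adj w' u := fun h => n2 h.symm
    have n3' : ¬ C.G.Adj u' v := fun h => n3 h.symm
    have n4' : ¬ C.G.Adj w' v := fun h => n4 h.symm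
    have n5' : ¬ C.G.Adj u' w := fun h => n5 h.symm
    have n6' : ¬ C.G.Adj v' w := fun h => n6 h.symm
    have : ∀ i j : Fin 6, C.G.Adj (f i) (f j) ↔ prismGraph.Adj i j := by
      intro i j
      unfold prismGraph
      fin_cases i <;> fin_cases j <;>
        simp [f, h1, h2, h3, h4, h5, h6, h7, h8, h9, h1.symm, h2.symm, h3.symm, h4.symm,
          h5.symm, h6.symm, h7.symm, h8.symm, h9.symm, n1, n2, n3, n4, n5, n6, n1', n2', n3', n4',
          n5', n6']
    exact this
  · have : ∀ i j : Fin 6, s(f i, f j) ∈ C.X ↔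
        s(i, j) ∈ ({s(0, 3), s(1, 4), s(2, 5)} : Set (Sym2 (Fin 6))) := by
      intro i j
      have e1 : s(u, u') = s(f 0, f 3) := rfl
      have e2 : s(v, v') = s(f 1, f 4) := rfl
      have e3 : s(w, w') = s(f 2, f 5) := rfl
      rw [hX, e1, e2, e3]
      simp only [Sym2.eq_iff, hinj.eq_iff, Set.mem_insert_iff, Set.mem_singleton_iff]
    exact this

end threeComponents

section finalPart

/-- A path with three vertices lies on one side of a separation. -/
theorem path_three {V : Type*} {G : SimpleGraph V} {P Q : Set V}
    (hE : ∀ p ∈ P, ∀ q ∈ Q, ¬ G.Adj p q) {p q x y z : V} (hp : p ∈ P) (hq : q ∈ Q)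
    (hxy : G.Adj x y) (hyz : G.Adj y z) (hx : x ∈ P ∨ x ∈ Q) (hy : y ∈ P ∨ y ∈ Q)
    (hz : z ∈ P ∨ z ∈ Q) (hp' : p = x ∨ p = y ∨ p = z) (hq' : q = x ∨ q = y ∨ q = z) : False := by
  have step : ∀ s t, G.Adj s t → s ∈ P → t ∉ Q := fun s t h h1 h2 => hE s h1 t h2 h
  have s1 := step _ _ hxy
  have s2 := step _ _ hxy.symm
  have s3 := step _ _ hyz
  have s4 := step _ _ hyz.symm
  have s5 : ∀ t, G.Adj t t → False := fun t h => h.ne rfl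
  rcases hp' with rfl | rfl | rfl <;> rcases hq' with rfl | rfl | rfl <;> tauto

theorem prism_of (C : CGraph) (hc : 3 < Nat.card C.V) (hN : NoSep ∅ C.G) (m : C.V → C.V)
    (hXm : ∀ p q, s(p, q) ∈ C.X ↔ q = m p) (hmm : ∀ z, m (m z) = z) (hne : ∀ z, m z ≠ z)
    (hadj : ∀ z, C.G.Adj z (m z)) (hsm : ∀ z y, C.G.Adj z y → y ≠ m z → SmallAt C.G z y)
    (hcr : ∀ z y, C.G.Adj z y → y ≠ m z → ¬ C.G.Adj z (m y))
    (hsep : ∀ z y, C.G.Adj z y → y ≠ m z → ∃ w P Q, Sep3 C.G z y w P Q)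
    (hfour : ∀ z y p q, C.G.Adj z y → y ≠ m z → p ≠ z → p ≠ m z → p ≠ y → p ≠ m y →
      q ≠ z → q ≠ m z → q ≠ y → q ≠ m y → q = p ∨ q = m p) (u : C.V) : CGIso C weirdPrism := by
  obtain ⟨v, huv, hvu', -⟩ := exists_nbr hc hN u (m u) (m u)
  obtain ⟨w, huw, hwv, hwu'⟩ := exists_nbr hc hN u v (m u)
  have full : ∀ z x y, C.G.Adj z x → C.G.Adj z y → x ≠ y → x ≠ m z → y ≠ m z →
      ∀ t, C.G.Adj z t → t = x ∨ t = y ∨ t = m z := by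
    intro z x y h1 h2 h3 h4 h5 t ht
    by_contra hcon
    push Not at hcon
    have := small_three (hsm z x h1 h4) h2 (hadj z) ht h3.symm (Ne.symm h4) hcon.1
    grind
  have fu := full u v w huv huw hwv.symm hvu' hwu'
  have hwv' : w ≠ m v := by
    rintro rfl
    exact hcr u v huv hvu' huw
  have minj : ∀ x y, m x = m y → x = y := fun x y h => by rw [← hmm x, h, hmm]
  have muv : m u ≠ m v := fun h => huv.ne (minj _ _ h)
  have muw : m u ≠ m w := fun h => huw.ne (minj _ _ h)
  have mvw : m v ≠ m w := fun h => hwv (minj _ _ h).symm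
  have huv' : u ≠ m v := by
    intro h
    apply hvu'
    rw [h, hmm]
  have huw' : u ≠ m w := by
    intro h
    apply hwu'
    rw [h, hmm]
  have hvw' : v ≠ m w := by
    intro h
    apply hwv'
    rw [h, hmm]
  have hall : ∀ z, z = u ∨ z = v ∨ z = w ∨ z = m u ∨ z = m v ∨ z = m w := by
    intro z
    have := hfour u v w z huv hvu' huw.ne' hwu' hwv hwv'
    tauto
  have du := hne u
  have dv := hne v
  have dw := hne w
  have hnd : [u, v, w, m u, m v, m w].Nodup := by
    have e1 := huv.ne
    have e2 := huw.ne
    simp only [List.nodup_cons, List.mem_cons, List.not_mem_nil, or_false, not_or, List.nodup_nil]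
    exact ⟨⟨e1, e2, du.symm, huv', huw'⟩, ⟨hwv.symm, hvu', dv.symm, hvw'⟩, ⟨hwu', hwv', dw.symm⟩,
      ⟨muv, muw⟩, mvw, not_false, trivial⟩
  have n1 : ¬ C.G.Adj u (m v) := hcr u v huv hvu'
  have n2 : ¬ C.G.Adj u (m w) := hcr u w huw hwu'
  have n3 : ¬ C.G.Adj v (m u) := hcr v u huv.symm huv'
  have n5 : ¬ C.G.Adj w (m u) := hcr w u huw.symm huw'
  by_cases hvw : C.G.Adj v w
  · have n4 : ¬ C.G.Adj v (m w) := hcr v w hvw hwv'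
    have n6 : ¬ C.G.Adj w (m v) := hcr w v hvw.symm hvw'
    have h6 : C.G.Adj (m u) (m w) := by
      obtain ⟨x, hx, e1, e2⟩ := exists_nbr hc hN (m u) u (m v)
      have := hx.ne
      rcases hall x with rfl | rfl | rfl | rfl | rfl | rfl
      · contradiction
      · exact absurd hx.symm n3
      · exact absurd hx.symm n5
      · contradiction
      · contradiction
      · exact hx
    have h4 : C.G.Adj (m u) (m v) := by
      obtain ⟨x, hx, e1, e2⟩ := exists_nbr hc hN (m u) u (m w)
      have := hx.ne
      rcases hall x with rfl | rfl | rfl | rfl | rfl | rfl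
      · contradiction
      · exact absurd hx.symm n3
      · exact absurd hx.symm n5
      · contradiction
      · exact hx
      · contradiction
    have h5 : C.G.Adj (m v) (m w) := by
      obtain ⟨x, hx, e1, e2⟩ := exists_nbr hc hN (m v) v (m u)
      have := hx.ne
      rcases hall x with rfl | rfl | rfl | rfl | rfl | rfl
      · exact absurd hx.symm n1
      · contradiction
      · exact absurd hx.symm n6
      · contradiction
      · contradiction
      · exact hx
    refine prism_iso C hall ?_ hnd huv hvw huw h4 h5 h6 (hadj u) (hadj v) (hadj w) n1 n2 n3 n4 n5 n6
    intro p q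
    have k1 := hXm u (m u)
    have k2 := hXm v (m v)
    have k3 := hXm w (m w)
    constructor
    · intro h
      rw [hXm] at h
      subst h
      simp only [Sym2.eq_iff]
      rcases hall p with rfl | rfl | rfl | rfl | rfl | rfl <;> simp [hmm]
    · rintro (h | h | h) <;> rw [h, hXm]
  · exfalso
    have hvw2 : C.G.Adj v (m w) := by
      obtain ⟨x, hx, e1, e2⟩ := exists_nbr hc hN v u (m v)
      have := hx.ne
      rcases hall x with rfl | rfl | rfl | rfl | rfl | rfl <;> first | contradiction | exact hx
    have fv := full v u (m w) huv.symm hvw2 huw' huv' (Ne.symm mvw)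
    have p1 : C.G.Adj w (m v) := by
      obtain ⟨x, hx, e1, e2⟩ := exists_nbr hc hN w u (m w)
      have := hx.ne
      have := hx.symm
      rcases hall x with rfl | rfl | rfl | rfl | rfl | rfl <;> first | contradiction | exact hx
    have n7 : ¬ C.G.Adj (m w) (m v) := hcr (m w) v hvw2.symm (by rw [hmm]; exact hwv.symm)
    have p2 : C.G.Adj (m w) (m u) := by
      obtain ⟨x, hx, e1, e2⟩ := exists_nbr hc hN (m w) v w
      have := hx.ne
      have := hx.symm
      rcases hall x with rfl | rfl | rfl | rfl | rfl | rfl <;> first | contradiction | exact hx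
    have p3 : C.G.Adj (m v) (m u) := by
      obtain ⟨x, hx, e1, e2⟩ := exists_nbr hc hN (m v) v w
      have := hx.ne
      have := hx.symm
      rcases hall x with rfl | rfl | rfl | rfl | rfl | rfl <;> first | contradiction | exact hx
    have p4 := hadj w
    obtain ⟨z, P, Q, ⟨p, hp⟩, ⟨q, hq⟩, z1, z2, z3, z4, z5⟩ := hsep u v huv hvu'
    have cl : ∀ t, t ≠ u → t ≠ v → t ≠ z → t ∈ P ∨ t ∈ Q := by
      intro t h1 h2 h3
      have := z4 t
      tauto
    have tu := (z4 u).1 (Or.inl rfl)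
    have tv := (z4 v).1 (Or.inr (Or.inl rfl))
    have tz := (z4 z).1 (Or.inr (Or.inr rfl))
    have ne : ∀ t, t ∉ P ∧ t ∉ Q → p ≠ t ∧ q ≠ t := by
      intro t ht
      refine ⟨?_, ?_⟩
      · rintro rfl
        exact ht.1 hp
      · rintro rfl
        exact ht.2 hq
    have eu := ne u tu
    have ev := ne v tv
    have ez := ne z tz
    have a1 := ((hall p).resolve_left eu.1).resolve_left ev.1
    have a2 := ((hall q).resolve_left eu.2).resolve_left ev.2
    rcases hall z with rfl | rfl | rfl | rfl | rfl | rfl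
    · contradiction
    · contradiction
    · exact path_three z5 hp hq p2 p3.symm (cl _ huw'.symm hvw'.symm dw) (cl _ du hvu'.symm hwu'.symm)
        (cl _ huv'.symm dv hwv'.symm) (by clear * - a1 ez; tauto)
        (by clear * - a2 ez; tauto)
    · exact path_three z5 hp hq p1.symm p4 (cl _ huv'.symm dv muv.symm)
        (cl _ huw.ne' hwv hwu') (cl _ huw'.symm hvw'.symm muw.symm) (by clear * - a1 ez; tauto)
        (by clear * - a2 ez; tauto)
    · exact path_three z5 hp hq p4 p2 (cl _ huw.ne' hwv hwv')
        (cl _ huw'.symm hvw'.symm mvw.symm) (cl _ du hvu'.symm muv) (by clear * - a1 ez; tauto)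
        (by clear * - a2 ez; tauto)
    · exact path_three z5 hp hq p1 p3 (cl _ huw.ne' hwv dw.symm)
        (cl _ huv'.symm dv mvw) (cl _ du hvu'.symm muw) (by clear * - a1 ez; tauto)
        (by clear * - a2 ez; tauto)

theorem induce_reach {V : Type*} {X : Set (Sym2 V)} {x z : V} (h : (fromEdgeSet X).Reachable x z)
    (hx : x ∈ (fromEdgeSet X).support) (hz : z ∈ (fromEdgeSet X).support) :
    (edgeSubgraph X).Reachable ⟨x, hx⟩ ⟨z, hz⟩ := by
  obtain ⟨w⟩ := h
  induction w with
  | nil => exact Reachable.refl _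
  | @cons a b c hadj w ih =>
    have hb : b ∈ (fromEdgeSet X).support := (mem_support _).2 ⟨a, hadj.symm⟩
    have : (edgeSubgraph X).Adj ⟨a, hx⟩ ⟨b, hb⟩ := hadj
    exact this.reachable.trans (ih hb hz)

theorem two_components {V : Type*} {X : Set (Sym2 V)} (hdisc : ¬ EdgeSetConnected X)
    (h : ∀ a ∈ (fromEdgeSet X).support, ∀ b ∈ (fromEdgeSet X).support,
      ∀ c ∈ (fromEdgeSet X).support, ¬ (fromEdgeSet X).Reachable a b →
      (fromEdgeSet X).Reachable a c ∨ (fromEdgeSet X).Reachable b c) : edgeComponents X = 2 := by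
  unfold EdgeSetConnected at hdisc
  push Not at hdisc
  obtain ⟨a, ha, c, hc, hac⟩ := hdisc
  unfold edgeComponents
  rw [Nat.card_eq_two_iff]
  refine ⟨(edgeSubgraph X).connectedComponentMk ⟨a, ha⟩,
    (edgeSubgraph X).connectedComponentMk ⟨c, hc⟩, ?_, ?_⟩
  · intro heq
    rw [ConnectedComponent.eq] at heq
    exact hac (heq.map (Embedding.induce _).toHom)
  · rw [Set.eq_univ_iff_forall]
    intro K
    induction K using ConnectedComponent.ind with | _ z
    obtain ⟨z, hz⟩ := z
    rcases h a ha c hc z hz hac with h | h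
    · left
      exact (ConnectedComponent.eq.2 (induce_reach h ha hz)).symm
    · right
      exact (ConnectedComponent.eq.2 (induce_reach h hc hz)).symm

theorem three_prism (C : CGraph) (hWF : C.WF) (h3 : KConnected 3 C.G)
    (hess : ∀ e ∈ C.G.edgeSet, e ∉ C.X → Essential C e)
    (hm : ∀ z, ∃ z', s(z, z') ∈ C.X) {p₁ p₂ p₃ : C.V}
    (h12 : ¬ (fromEdgeSet C.X).Reachable p₁ p₂) (h13 : ¬ (fromEdgeSet C.X).Reachable p₁ p₃)
    (h23 : ¬ (fromEdgeSet C.X).Reachable p₂ p₃) : CGIso C weirdPrism := by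
  have hW : ∀ p q, s(p, q) ∈ C.X → C.G.Adj p q := fun p q h => hWF h
  have hk := (kconn_iff _).1 h3
  choose m hmX using hm
  have hcard : 4 < Nat.card C.V := by
    have e1 := fun i => reach_of (hmX i)
    have e2 := fun i => (hW _ _ (hmX i)).ne
    have f1 : p₁ ≠ p₂ := by rintro rfl; exact h12 (Reachable.refl _)
    have f2 : p₁ ≠ p₃ := by rintro rfl; exact h13 (Reachable.refl _)
    have f3 : p₂ ≠ p₃ := by rintro rfl; exact h23 (Reachable.refl _)
    have f4 : p₁ ≠ m p₂ := by intro h; apply h12; rw [h]; exact (e1 _).symm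
    have f5 : m p₁ ≠ p₂ := by intro h; apply h12; rw [← h]; exact e1 _
    have f6 : m p₁ ≠ p₃ := by intro h; apply h13; rw [← h]; exact e1 _
    have f7 : m p₂ ≠ p₃ := by intro h; apply h23; rw [← h]; exact e1 _
    have f8 : m p₁ ≠ m p₂ := by
      intro h; apply h12; exact (e1 _).trans (h ▸ (e1 _).symm)
    have g1 := e2 p₁
    have g2 := e2 p₂
    classical
    have h5 : ({p₁, m p₁, p₂, m p₂, p₃} : Finset C.V).card = 5 := by
      clear h3 hess hk hmX hW hWF e1 e2
      repeat rw [Finset.card_insert_of_notMem (by simp; grind)]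
      simp
    haveI := Fintype.ofFinite C.V
    have := Finset.card_le_univ ({p₁, m p₁, p₂, m p₂, p₃} : Finset C.V)
    rw [Nat.card_eq_fintype_card]
    omega
  have hthree : ∀ u v, ∃ w, ¬ (fromEdgeSet C.X).Reachable u w ∧
      ¬ (fromEdgeSet C.X).Reachable v w := by
    intro u v
    by_contra hcon
    push Not at hcon
    have c1 := hcon p₁
    have c2 := hcon p₂
    have c3 := hcon p₃
    by_cases a1 : (fromEdgeSet C.X).Reachable u p₁
    · have a2 := c2 (fun h => h12 (a1.symm.trans h))
      have a3 := c3 (fun h => h13 (a1.symm.trans h))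
      exact h23 (a2.symm.trans a3)
    · by_cases a2 : (fromEdgeSet C.X).Reachable u p₂
      · have a3 := c3 (fun h => h23 (a2.symm.trans h))
        exact h13 ((c1 a1).symm.trans a3)
      · exact h12 ((c1 a1).symm.trans (c2 a2))
  have hm : ∀ z, ∃ z', s(z, z') ∈ C.X := fun z => ⟨m z, hmX z⟩
  have H := fun u v (huv : C.G.Adj u v) (hX : s(u, v) ∉ C.X) =>
    three_hyp C hWF h3 hcard hess hm hthree huv hX
  have E := fun u v (huv : C.G.Adj u v) (hX : s(u, v) ∉ C.X) =>
    three_edge hW hm hthree hX (H u v huv hX).2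
  have huniq : ∀ z x y, s(x, y) ∈ C.X → (fromEdgeSet C.X).Reachable z x → s(x, y) = s(z, m z) := by
    intro z x y hxy hzx
    have hedge : ∃ u v, C.G.Adj u v ∧ (fromEdgeSet C.X).Reachable z u ∧
        ¬ (fromEdgeSet C.X).Reachable z v := by
      by_contra hcon
      push Not at hcon
      obtain ⟨w, hw, -⟩ := hthree z z
      obtain ⟨y, hy1, hy2, -⟩ := hk.2 {t | (fromEdgeSet C.X).Reachable z t}
        {t | ¬ (fromEdgeSet C.X).Reachable z t} ⟨z, Reachable.refl _, by simp⟩ ⟨w, hw, by simp⟩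
        (fun y hy hy' => hy' hy) (fun a ha b hb hab => hb (hcon a b hab ha)) z z
      exact hy2 hy1
    obtain ⟨u, v, huv, hu, hv⟩ := hedge
    have hX : s(u, v) ∉ C.X := fun h => hv (hu.trans (reach_of h))
    have hs := (E u v huv hX).2.2.1
    rw [← hs _ _ _ (hmX u) hxy (hu.symm.trans hzx), hs _ _ _ (hmX u) (hmX z) hu.symm]
  have hXm : ∀ p q, s(p, q) ∈ C.X ↔ q = m p := by
    intro p q
    constructor
    · intro h
      have := huniq p p q h (Reachable.refl _)
      have hne := (hW _ _ h).ne
      rw [Sym2.eq_iff] at this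
      rcases this with ⟨-, h⟩ | ⟨-, h⟩
      · exact h
      · exact absurd h.symm hne
    · rintro rfl
      exact hmX p
  have hmm : ∀ z, m (m z) = z := fun z =>
    ((hXm (m z) z).1 (by rw [Sym2.eq_swap]; exact hmX z)).symm
  have hR : ∀ z y, (fromEdgeSet C.X).Reachable z y → y = z ∨ y = m z := by
    intro z y h
    have := huniq z y (m y) (hmX y) h
    rw [Sym2.eq_iff] at this
    tauto
  have hE : ∀ u v, C.G.Adj u v → v ≠ m u → _ := fun u v huv hv =>
    E u v huv (fun h => hv ((hXm u v).1 h))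
  refine prism_of C hk.1 hk.2 m hXm hmm (fun z => (hW _ _ (hmX z)).ne') (fun z => hW _ _ (hmX z))
    (fun z y h h' => (hE z y h h').1) (fun z y h h' => (hE z y h h').2.2.2.2 _ (hmX y))
    (fun z y h h' => (H z y h (fun hh => h' ((hXm z y).1 hh))).1) ?_ p₁
  intro z y p q h h' a1 a2 a3 a4 b1 b2 b3 b4
  apply hR
  refine (hE z y h h').2.2.2.1 p q ?_ ?_ ?_ ?_
  · intro h; have := hR _ _ h; tauto
  · intro h; have := hR _ _ h; tauto
  · intro h; have := hR _ _ h; tauto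
  · intro h; have := hR _ _ h; tauto

end finalPart


/-- **Lemma (summary).** If `X` is disconnected, every edge not in `X` is essential and
`(G, X)` is neither the constraint wheel nor the weird prism, then `G[X]` has precisely two
components and every edge not in `X` has both endvertices in `V(X)`. -/
theorem summary_two_components (C : CGraph) (hWF : C.WF) (h3 : KConnected 3 C.G)
    (hdisc : ¬ EdgeSetConnected C.X)
    (hess : ∀ e ∈ C.G.edgeSet, e ∉ C.X → Essential C e)
    (hwheel : ¬ CGIso C constraintWheel) (hweird : ¬ CGIso C weirdPrism) :
    edgeComponents C.X = 2 ∧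
      ∀ e ∈ C.G.edgeSet, e ∉ C.X → ∀ x ∈ e, x ∈ (fromEdgeSet C.X).support := by
  have hcov : ∀ x, x ∈ (fromEdgeSet C.X).support := by
    intro x
    by_contra hx
    exact hwheel (uncovered_wheel C hWF h3 hdisc hess hx)
  refine ⟨two_components hdisc ?_, fun _ _ _ x _ => hcov x⟩
  intro a _ b _ c _ hab
  by_contra hcon
  push Not at hcon
  refine hweird (three_prism C hWF h3 hess ?_ hab hcon.1 hcon.2)
  intro z
  obtain ⟨z', hz, -⟩ := mem_supp.1 (hcov z)
  exact ⟨z', hz⟩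
end

section
/- Let Q be a graph that is 3-connected along a bond d such that both sides of d contain edges. Then (Q,d) has a special contraction minor that is the special K4 or the special prism. -/
open SimpleGraph

namespace SMC

/-- Cut-based connectedness of a vertex set. -/
def Cn {V : Type} (G : SimpleGraph V) (s : Set V) : Prop :=
  s.Nonempty ∧ ∀ P ⊆ s, P.Nonempty → (s \ P).Nonempty → ∃ a ∈ P, ∃ b ∈ s \ P, G.Adj a b

/-- There is an edge between two sets. -/
def Ad {V : Type} (G : SimpleGraph V) (s t : Set V) : Prop := ∃ a ∈ s, ∃ b ∈ t, G.Adj a b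

lemma Ad.symm {V : Type} {G : SimpleGraph V} {s t : Set V} (h : Ad G s t) : Ad G t s := by
  obtain ⟨a, ha, b, hb, hab⟩ := h
  exact ⟨b, hb, a, ha, hab.symm⟩

lemma Ad.mono {V : Type} {G : SimpleGraph V} {s t s' t' : Set V} (h : Ad G s t)
    (hs : s ⊆ s') (ht : t ⊆ t') : Ad G s' t' := by
  obtain ⟨a, ha, b, hb, hab⟩ := h
  exact ⟨a, hs ha, b, ht hb, hab⟩

lemma cn_of_preconnected {V : Type} {G : SimpleGraph V} {s : Set V}
    (h : (G.induce s).Preconnected) : ∀ P ⊆ s, P.Nonempty → (s \ P).Nonempty →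
      ∃ a ∈ P, ∃ b ∈ s \ P, G.Adj a b := by
  rintro P hP ⟨a, ha⟩ ⟨b, hb⟩
  obtain ⟨w⟩ := h ⟨a, hP ha⟩ ⟨b, hb.1⟩
  by_contra hcon
  push Not at hcon
  have key : ∀ (u v : s) (w : (G.induce s).Walk u v), u.1 ∈ P → v.1 ∈ P := by
    intro u v w
    induction w with
    | nil => exact id
    | @cons x y z hxy _ ih =>
      intro hx
      apply ih
      by_contra hy
      exact hcon _ hx _ ⟨y.2, hy⟩ hxy
  exact hb.2 (key _ _ w ha)

lemma cn_singleton {V : Type} (G : SimpleGraph V) (a : V) : Cn G {a} := by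
  refine ⟨⟨a, rfl⟩, ?_⟩
  rintro P hP ⟨b, hb⟩ ⟨c, hc, hcP⟩
  have h1 := hP hb
  simp only [Set.mem_singleton_iff] at h1 hc
  subst h1; subst hc
  exact absurd hb hcP

lemma Cn.cross {V : Type} {G : SimpleGraph V} {s : Set V} (h : Cn G s) (Q : Set V)
    {a b : V} (ha : a ∈ s) (haQ : a ∈ Q) (hb : b ∈ s) (hbQ : b ∉ Q) :
    ∃ c ∈ s, ∃ d ∈ s, c ∈ Q ∧ d ∉ Q ∧ G.Adj c d := by
  obtain ⟨c, hc, d, hd, hcd⟩ := h.2 (s ∩ Q) Set.inter_subset_left ⟨a, ha, haQ⟩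
    ⟨b, hb, fun h => hbQ h.2⟩
  exact ⟨c, hc.1, d, hd.1, hc.2, fun h => hd.2 ⟨hd.1, h⟩, hcd⟩

lemma cn_of_cross {V : Type} {G : SimpleGraph V} {s : Set V} (hne : s.Nonempty)
    (h : ∀ Q : Set V, ∀ a ∈ s, a ∈ Q → ∀ b ∈ s, b ∉ Q →
      ∃ c ∈ s, ∃ d ∈ s, c ∈ Q ∧ d ∉ Q ∧ G.Adj c d) : Cn G s := by
  refine ⟨hne, ?_⟩
  rintro P hP ⟨a, ha⟩ ⟨b, hb⟩
  obtain ⟨c, hc, d, hd, hcP, hdP, hcd⟩ := h P a (hP ha) ha b hb.1 hb.2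
  exact ⟨c, hcP, d, ⟨hd, hdP⟩, hcd⟩

lemma cn_union_adj {V : Type} {G : SimpleGraph V} {s t : Set V} (hs : Cn G s) (ht : Cn G t)
    (h : Ad G s t) : Cn G (s ∪ t) := by
  refine cn_of_cross (hs.1.mono Set.subset_union_left) ?_
  intro Q a ha haQ b hb hbQ
  by_contra hcon
  push Not at hcon
  obtain ⟨p, hp, q, hq, hpq⟩ := h
  have Hs : ∀ u ∈ s, ∀ v ∈ s, u ∈ Q → v ∈ Q := by
    intro u hu v hv huQ
    by_contra hvQ
    obtain ⟨c, hc, d, hd, h1, h2, h3⟩ := hs.cross Q hu huQ hv hvQ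
    exact hcon c (Or.inl hc) d (Or.inl hd) h1 h2 h3
  have Ht : ∀ u ∈ t, ∀ v ∈ t, u ∈ Q → v ∈ Q := by
    intro u hu v hv huQ
    by_contra hvQ
    obtain ⟨c, hc, d, hd, h1, h2, h3⟩ := ht.cross Q hu huQ hv hvQ
    exact hcon c (Or.inr hc) d (Or.inr hd) h1 h2 h3
  have H1 : p ∈ Q → q ∈ Q := fun h => by
    by_contra h'
    exact hcon p (Or.inl hp) q (Or.inr hq) h h' hpq
  have H2 : q ∈ Q → p ∈ Q := fun h => by
    by_contra h'
    exact hcon q (Or.inr hq) p (Or.inl hp) h h' hpq.symm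
  rcases ha with ha | ha <;> rcases hb with hb | hb
  · exact hbQ (Hs a ha b hb haQ)
  · exact hbQ (Ht q hq b hb (H1 (Hs a ha p hp haQ)))
  · exact hbQ (Hs p hp b hb (H2 (Ht a ha q hq haQ)))
  · exact hbQ (Ht a ha b hb haQ)

lemma cn_union_meet {V : Type} {G : SimpleGraph V} {s t : Set V} (hs : Cn G s) (ht : Cn G t)
    {m : V} (hms : m ∈ s) (hmt : m ∈ t) : Cn G (s ∪ t) := by
  refine cn_of_cross (hs.1.mono Set.subset_union_left) ?_
  intro Q a ha haQ b hb hbQ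
  by_contra hcon
  push Not at hcon
  have Hs : ∀ u ∈ s, ∀ v ∈ s, u ∈ Q → v ∈ Q := by
    intro u hu v hv huQ
    by_contra hvQ
    obtain ⟨c, hc, d, hd, h1, h2, h3⟩ := hs.cross Q hu huQ hv hvQ
    exact hcon c (Or.inl hc) d (Or.inl hd) h1 h2 h3
  have Ht : ∀ u ∈ t, ∀ v ∈ t, u ∈ Q → v ∈ Q := by
    intro u hu v hv huQ
    by_contra hvQ
    obtain ⟨c, hc, d, hd, h1, h2, h3⟩ := ht.cross Q hu huQ hv hvQ
    exact hcon c (Or.inr hc) d (Or.inr hd) h1 h2 h3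
  rcases ha with ha | ha <;> rcases hb with hb | hb
  · exact hbQ (Hs a ha b hb haQ)
  · exact hbQ (Ht m hmt b hb (Hs a ha m hms haQ))
  · exact hbQ (Hs m hms b hb (Ht a ha m hmt haQ))
  · exact hbQ (Ht a ha b hb haQ)

lemma cn_insert {V : Type} {G : SimpleGraph V} {s : Set V} (hs : Cn G s) {a b : V}
    (ha : a ∈ s) (hab : G.Adj a b) : Cn G (s ∪ {b}) :=
  cn_union_adj hs (cn_singleton G b) ⟨a, ha, b, rfl, hab⟩

/-- Components: a maximal connected subset of `K` containing `y`. -/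
lemma exists_component {V : Type} [Finite V] (G : SimpleGraph V) (K : Set V) {y : V} (hy : y ∈ K) :
    ∃ P ⊆ K, Cn G P ∧ y ∈ P ∧ ∀ a ∈ P, ∀ b ∈ K, G.Adj a b → b ∈ P := by
  obtain ⟨P, hP⟩ := (Set.toFinite {P : Set V | P ⊆ K ∧ Cn G P ∧ y ∈ P}).exists_maximal
    ⟨{y}, by simpa using hy, cn_singleton G y, rfl⟩
  refine ⟨P, hP.1.1, hP.1.2.1, hP.1.2.2, ?_⟩
  intro a ha b hb hab
  have h2 : P ∪ {b} ⊆ P := hP.2 ⟨Set.union_subset hP.1.1 (by simpa using hb),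
    cn_insert hP.1.2.1 ha hab, Or.inl hP.1.2.2⟩ Set.subset_union_left
  exact h2 (Or.inr rfl)

lemma exists_attach {V : Type} [Finite V] {G : SimpleGraph V} {K : Set V} (hK : Cn G K) {x y : V}
    (hx : x ∈ K) (hy : y ∈ K) (hxy : y ≠ x) :
    ∃ P ⊆ K \ {x}, Cn G P ∧ y ∈ P ∧ ∃ n ∈ P, G.Adj x n := by
  obtain ⟨P, hPK, hP, hyP, hmax⟩ := exists_component G (K \ {x}) (y := y) ⟨hy, hxy⟩
  refine ⟨P, hPK, hP, hyP, ?_⟩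
  obtain ⟨c, hc, d, hd, hcP, hdP, hcd⟩ := hK.cross P hy hyP hx (fun h => (hPK h).2 rfl)
  by_cases hdx : d = x
  · subst hdx
    exact ⟨c, hcP, hcd.symm⟩
  · exact absurd (hmax c hcP d ⟨hd, hdx⟩ hcd) hdP

/-- Extend two disjoint connected sets to a partition. -/
lemma extend {V : Type} [Finite V] {G : SimpleGraph V} {W B1 B2 : Set V} (hW : Cn G W)
    (h1 : Cn G B1) (h2 : Cn G B2) (h1W : B1 ⊆ W) (h2W : B2 ⊆ W) (hd : Disjoint B1 B2) :
    ∃ C1 C2, B1 ⊆ C1 ∧ B2 ⊆ C2 ∧ Cn G C1 ∧ Cn G C2 ∧ Disjoint C1 C2 ∧ C1 ∪ C2 = W := by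
  obtain ⟨⟨C1, C2⟩, hP⟩ := (Set.toFinite {p : Set V × Set V | B1 ⊆ p.1 ∧ B2 ⊆ p.2 ∧ Cn G p.1 ∧
    Cn G p.2 ∧ Disjoint p.1 p.2 ∧ p.1 ⊆ W ∧ p.2 ⊆ W}).exists_maximal
    ⟨(B1, B2), subset_rfl, subset_rfl, h1, h2, hd, h1W, h2W⟩
  obtain ⟨⟨a1, a2, a3, a4, a5, a6, a7⟩, hmax⟩ := hP
  simp only at a1 a2 a3 a4 a5 a6 a7
  refine ⟨C1, C2, a1, a2, a3, a4, a5, ?_⟩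
  refine (Set.union_subset a6 a7).antisymm ?_
  by_contra hcon
  obtain ⟨b, hbW, hb⟩ := Set.not_subset.1 hcon
  obtain ⟨a, ha⟩ := a3.1
  obtain ⟨c, hc, d, hd, hcP, hdP, hcd⟩ := hW.cross (C1 ∪ C2) (a6 ha) (Or.inl ha) hbW hb
  rcases hcP with hc1 | hc2
  · have := hmax (y := (C1 ∪ {d}, C2)) ⟨a1.trans Set.subset_union_left, a2, cn_insert a3 hc1 hcd,
      a4, by
        rw [Set.disjoint_union_left]
        exact ⟨a5, by rw [Set.disjoint_singleton_left]; exact fun h => hdP (Or.inr h)⟩,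
      Set.union_subset a6 (by simpa using hd), a7⟩ ⟨Set.subset_union_left, subset_rfl⟩
    exact hdP (Or.inl (this.1 (Or.inr rfl)))
  · have := hmax (y := (C1, C2 ∪ {d})) ⟨a1, a2.trans Set.subset_union_left, a3,
      cn_insert a4 hc2 hcd, by
        rw [Set.disjoint_union_right]
        exact ⟨a5, by rw [Set.disjoint_singleton_right]; exact fun h => hdP (Or.inl h)⟩,
      a6, Set.union_subset a7 (by simpa using hd)⟩ ⟨subset_rfl, Set.subset_union_left⟩
    exact hdP (Or.inr (this.2 (Or.inr rfl)))

/-- Menger for two paths. -/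
lemma menger2 {V : Type} [Finite V] [Nonempty V] (G : SimpleGraph V) (Y : Set V) :
    ∀ (n : ℕ) (U X : Set V), U.ncard = n →
    (∀ z, ∃ K ⊆ U \ {z}, Cn G K ∧ (K ∩ X).Nonempty ∧ (K ∩ Y).Nonempty) →
    ∃ B1 B2, B1 ⊆ U ∧ B2 ⊆ U ∧ Disjoint B1 B2 ∧ Cn G B1 ∧ Cn G B2 ∧
      (B1 ∩ X).Nonempty ∧ (B1 ∩ Y).Nonempty ∧ (B2 ∩ X).Nonempty ∧ (B2 ∩ Y).Nonempty := by
  intro n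
  induction n with
  | zero =>
    intro U X hU h
    rw [Set.ncard_eq_zero] at hU
    obtain ⟨K, hK, -, ⟨a, ha⟩, -⟩ := h (Classical.arbitrary V)
    have := (hK ha.1).1
    simp [hU] at this
  | succ n ih =>
    intro U X hU h
    by_cases hx : ∃ x, x ∈ U ∧ x ∈ X ∧ x ∉ Y
    · obtain ⟨x, hxU, hxX, hxY⟩ := hx
      obtain ⟨K0, hK0, hK0c, ⟨x2, hx2⟩, ⟨y2, hy2⟩⟩ := h x
      obtain ⟨B1, B2, h1U, h2U, hd, h1, h2, hX1, hY1, hX2, hY2⟩ :=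
        ih (U \ {x}) (X ∪ {v | G.Adj x v}) (by
          rw [Set.ncard_sdiff_singleton_of_mem hxU, hU]; rfl) (by
          intro z
          obtain ⟨K, hK, hKc, ⟨a, ha⟩, ⟨y, hy⟩⟩ := h z
          by_cases hxK : x ∈ K
          · obtain ⟨P, hPK, hP, hyP, m, hm, hxm⟩ := exists_attach hKc hxK hy.1
              (fun h => hxY (h ▸ hy.2))
            exact ⟨P, fun p hp => ⟨⟨(hK (hPK hp).1).1, (hPK hp).2⟩, (hK (hPK hp).1).2⟩, hP,
              ⟨m, hm, Or.inr hxm⟩, ⟨y, hyP, hy.2⟩⟩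
          · exact ⟨K, fun p hp => ⟨⟨(hK hp).1, fun h => hxK (h ▸ hp)⟩, (hK hp).2⟩, hKc,
              ⟨a, ha.1, Or.inl ha.2⟩, ⟨y, hy⟩⟩)
      -- finishing: a set meeting `X ∪ N(x)` together with one meeting `X`
      have fin : ∀ D E : Set V, D ⊆ U \ {x} → E ⊆ U \ {x} → Disjoint D E → Cn G D → Cn G E →
          (D ∩ (X ∪ {v | G.Adj x v})).Nonempty → (D ∩ Y).Nonempty → (E ∩ X).Nonempty →
          (E ∩ Y).Nonempty → ∃ B1 B2, B1 ⊆ U ∧ B2 ⊆ U ∧ Disjoint B1 B2 ∧ Cn G B1 ∧ Cn G B2 ∧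
          (B1 ∩ X).Nonempty ∧ (B1 ∩ Y).Nonempty ∧ (B2 ∩ X).Nonempty ∧ (B2 ∩ Y).Nonempty := by
        rintro D E hDU hEU hDE hD hE ⟨a, haD, ha⟩ hDY hEX hEY
        rcases ha with ha | ha
        · exact ⟨D, E, fun p hp => (hDU hp).1, fun p hp => (hEU hp).1, hDE, hD, hE, ⟨a, haD, ha⟩,
            hDY, hEX, hEY⟩
        · refine ⟨D ∪ {x}, E, Set.union_subset (fun p hp => (hDU hp).1) (by simpa using hxU),
            fun p hp => (hEU hp).1, ?_, cn_insert hD haD (G.adj_symm ha), hE,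
            ⟨x, Or.inr rfl, hxX⟩, hDY.mono (fun p hp => ⟨Or.inl hp.1, hp.2⟩), hEX, hEY⟩
          rw [Set.disjoint_union_left, Set.disjoint_singleton_left]
          exact ⟨hDE, fun h => (hEU h).2 rfl⟩
      by_cases hm1 : Disjoint B1 K0
      · exact fin B1 K0 h1U hK0 hm1 h1 hK0c hX1 hY1 ⟨x2, hx2⟩ ⟨y2, hy2⟩
      by_cases hm2 : Disjoint B2 K0
      · exact fin B2 K0 h2U hK0 hm2 h2 hK0c hX2 hY2 ⟨x2, hx2⟩ ⟨y2, hy2⟩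
      obtain ⟨m1, hm1a, hm1b⟩ := Set.not_disjoint_iff.1 hm1
      obtain ⟨m2, hm2a, hm2b⟩ := Set.not_disjoint_iff.1 hm2
      have hW : Cn G ((B1 ∪ K0) ∪ B2) :=
        cn_union_meet (cn_union_meet h1 hK0c hm1a hm1b) h2 (m := m2) (Or.inr hm2b) hm2a
      have hWU : (B1 ∪ K0) ∪ B2 ⊆ U \ {x} := Set.union_subset (Set.union_subset h1U hK0) h2U
      obtain ⟨C1, C2, hBC1, hBC2, hC1, hC2, hCd, hCW⟩ := extend hW h1 h2
        (fun p hp => Or.inl (Or.inl hp)) (fun p hp => Or.inr hp) hd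
      have hC1U : C1 ⊆ U \ {x} := fun p hp => hWU (hCW ▸ Or.inl hp)
      have hC2U : C2 ⊆ U \ {x} := fun p hp => hWU (hCW ▸ Or.inr hp)
      have hx2m : x2 ∈ C1 ∪ C2 := by rw [hCW]; exact Or.inl (Or.inr hx2.1)
      rcases hx2m with hc | hc
      · exact fin C2 C1 hC2U hC1U hCd.symm hC2 hC1 (hX2.mono fun p hp => ⟨hBC2 hp.1, hp.2⟩)
          (hY2.mono fun p hp => ⟨hBC2 hp.1, hp.2⟩) ⟨x2, hc, hx2.2⟩
          (hY1.mono fun p hp => ⟨hBC1 hp.1, hp.2⟩)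
      · exact fin C1 C2 hC1U hC2U hCd hC1 hC2 (hX1.mono fun p hp => ⟨hBC1 hp.1, hp.2⟩)
          (hY1.mono fun p hp => ⟨hBC1 hp.1, hp.2⟩) ⟨x2, hc, hx2.2⟩
          (hY2.mono fun p hp => ⟨hBC2 hp.1, hp.2⟩)
    · push Not at hx
      obtain ⟨K, hK, -, ⟨a, ha⟩, -⟩ := h (Classical.arbitrary V)
      obtain ⟨K', hK', -, ⟨b, hb⟩, -⟩ := h a
      have haU := (hK ha.1).1
      have hbU := (hK' hb.1).1
      have hba : b ≠ a := (hK' hb.1).2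
      exact ⟨{a}, {b}, by simpa using haU, by simpa using hbU, by simpa using hba.symm,
        cn_singleton G a, cn_singleton G b, ⟨a, rfl, ha.2⟩, ⟨a, rfl, hx a haU ha.2⟩,
        ⟨b, rfl, hb.2⟩, ⟨b, rfl, hx b hbU hb.2⟩⟩

/-- Bipartition version of `menger2`. -/
lemma menger2' {V : Type} [Finite V] (G : SimpleGraph V) (U X Y : Set V)
    (hU : Cn G U)
    (h : ∀ z ∈ U, ∃ K ⊆ U \ {z}, Cn G K ∧ (K ∩ X).Nonempty ∧ (K ∩ Y).Nonempty) :
    ∃ B1 B2, B1 ∪ B2 = U ∧ Disjoint B1 B2 ∧ Cn G B1 ∧ Cn G B2 ∧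
      (B1 ∩ X).Nonempty ∧ (B1 ∩ Y).Nonempty ∧ (B2 ∩ X).Nonempty ∧ (B2 ∩ Y).Nonempty := by
  obtain ⟨u, hu⟩ := hU.1
  have : Nonempty V := ⟨u⟩
  obtain ⟨B1, B2, h1U, h2U, hd, h1, h2, hX1, hY1, hX2, hY2⟩ := menger2 G Y _ U X rfl (by
    intro z
    by_cases hz : z ∈ U
    · exact h z hz
    · obtain ⟨K, hK, h'⟩ := h u hu
      exact ⟨K, fun p hp => ⟨(hK hp).1, fun e => hz (e ▸ (hK hp).1)⟩, h'⟩)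
  obtain ⟨C1, C2, hBC1, hBC2, hC1, hC2, hCd, hCW⟩ := extend hU h1 h2 h1U h2U hd
  exact ⟨C1, C2, hCW, hCd, hC1, hC2, hX1.mono fun p hp => ⟨hBC1 hp.1, hp.2⟩,
    hY1.mono fun p hp => ⟨hBC1 hp.1, hp.2⟩, hX2.mono fun p hp => ⟨hBC2 hp.1, hp.2⟩,
    hY2.mono fun p hp => ⟨hBC2 hp.1, hp.2⟩⟩

/-- The abstract hypotheses. -/
structure Gd {V : Type} (G : SimpleGraph V) (L R : Set V) : Prop where
  disj : Disjoint L R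
  cover : ∀ v, v ∈ L ∨ v ∈ R
  cL : Cn G L
  cR : Cn G R
  twoL : ∀ x, ∃ a ∈ L, a ≠ x
  twoR : ∀ x, ∃ a ∈ R, a ≠ x
  pair : ∀ x ∈ L, ∀ y ∈ R, ∀ Q : Set V, ∀ a, a ≠ x → a ≠ y → a ∈ Q → ∀ b, b ≠ x → b ≠ y →
    b ∉ Q → ∃ c d, c ≠ x ∧ c ≠ y ∧ d ≠ x ∧ d ≠ y ∧ c ∈ Q ∧ d ∉ Q ∧ G.Adj c d

lemma Gd.symm {V : Type} {G : SimpleGraph V} {L R : Set V} (h : Gd G L R) : Gd G R L where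
  disj := h.disj.symm
  cover v := (h.cover v).symm
  cL := h.cR
  cR := h.cL
  twoL := h.twoR
  twoR := h.twoL
  pair x hx y hy Q a hax hay haQ b hbx hby hbQ := by
    obtain ⟨c, d, h1, h2, h3, h4, h5⟩ := h.pair y hy x hx Q a hay hax haQ b hby hbx hbQ
    exact ⟨c, d, h2, h1, h4, h3, h5⟩

/-- The bipartition data for the special `K₄`. -/
def HK4 {V : Type} (G : SimpleGraph V) (L R : Set V) : Prop :=
  ∃ A1 A2 B1 B2, A1 ∪ A2 = L ∧ Disjoint A1 A2 ∧ B1 ∪ B2 = R ∧ Disjoint B1 B2 ∧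
    Cn G A1 ∧ Cn G A2 ∧ Cn G B1 ∧ Cn G B2 ∧ Ad G A1 B1 ∧ Ad G A1 B2 ∧ Ad G A2 B1 ∧ Ad G A2 B2

lemma HK4.symm {V : Type} {G : SimpleGraph V} {L R : Set V} (h : HK4 G L R) : HK4 G R L := by
  obtain ⟨A1, A2, B1, B2, h1, h2, h3, h4, h5, h6, h7, h8, h9, h10, h11, h12⟩ := h
  exact ⟨B1, B2, A1, A2, h3, h4, h1, h2, h7, h8, h5, h6, h9.symm, h11.symm, h10.symm, h12.symm⟩

lemma hk4_of {V : Type} [Finite V] {G : SimpleGraph V} {L R : Set V} (h : Gd G L R)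
    {A1 A2 : Set V} (hA : A1 ∪ A2 = L) (hd : Disjoint A1 A2) (h1 : Cn G A1) (h2 : Cn G A2)
    (hK : ∀ z ∈ R, ∃ K ⊆ R \ {z}, Cn G K ∧ Ad G A1 K ∧ Ad G A2 K) : HK4 G L R := by
  obtain ⟨B1, B2, hB, hBd, c1, c2, ⟨p, hp1, a, ha, hpa⟩, ⟨q, hq1, b, hb, hqb⟩,
      ⟨r, hr1, c, hc, hrc⟩, ⟨s, hs1, d, hd', hsd⟩⟩ :=
    menger2' G R {v | ∃ a ∈ A1, G.Adj a v} {v | ∃ a ∈ A2, G.Adj a v} h.cR (by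
      intro z hz
      obtain ⟨K, hKR, hKc, ⟨a, ha, k, hk, hak⟩, ⟨b, hb, l, hl, hbl⟩⟩ := hK z hz
      exact ⟨K, hKR, hKc, ⟨k, hk, a, ha, hak⟩, ⟨l, hl, b, hb, hbl⟩⟩)
  exact ⟨A1, A2, B1, B2, hA, hd, hB, hBd, h1, h2, c1, c2, ⟨a, ha, p, hp1, hpa⟩,
    ⟨c, hc, r, hr1, hrc⟩, ⟨b, hb, q, hq1, hqb⟩, ⟨d, hd', s, hs1, hsd⟩⟩

/-- If the left side has a cutvertex, we find the special `K₄`. -/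
lemma hk4_of_cut {V : Type} [Finite V] {G : SimpleGraph V} {L R : Set V} (h : Gd G L R)
    {x : V} (hx : x ∈ L) (hcut : ¬ Cn G (L \ {x})) : HK4 G L R := by
  obtain ⟨y, hy, hyx⟩ := h.twoL x
  obtain ⟨C, hCL, hC, hyC, hmax⟩ := exists_component G (L \ {x}) (y := y) ⟨hy, hyx⟩
  have hxC : x ∉ C := fun hh => (hCL hh).2 rfl
  have hne : ∃ w, w ∈ L \ {x} ∧ w ∉ C := by
    by_contra hcon
    push Not at hcon
    exact hcut ((hCL.antisymm hcon) ▸ hC)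
  obtain ⟨w, hwL, hwC⟩ := hne
  have hrest : Cn G (L \ C) := by
    refine cn_of_cross ⟨x, hx, hxC⟩ ?_
    intro Q a ha haQ b hb hbQ
    by_cases hxQ : x ∈ Q
    · obtain ⟨c, hc, d, hd, hcQ, hdQ, hcd⟩ := h.cL.cross (Q ∪ C) ha.1 (Or.inl haQ) hb.1
        (fun hh => hh.elim hbQ hb.2)
      have hdC : d ∉ C := fun hh => hdQ (Or.inr hh)
      have hdx : d ≠ x := fun hh => hdQ (Or.inl (hh ▸ hxQ))
      have hcC : c ∉ C := fun hh => hdC (hmax c hh d ⟨hd, hdx⟩ hcd)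
      exact ⟨c, ⟨hc, hcC⟩, d, ⟨hd, hdC⟩, hcQ.resolve_right hcC, fun hh => hdQ (Or.inl hh), hcd⟩
    · obtain ⟨c, hc, d, hd, hcQ, hdQ, hcd⟩ := h.cL.cross (Q \ C) ha.1 ⟨haQ, ha.2⟩ hb.1
        (fun hh => hbQ hh.1)
      have hcx : c ≠ x := fun hh => hxQ (hh ▸ hcQ.1)
      have hdC : d ∉ C := fun hh => hcQ.2 (hmax d hh c ⟨hc, hcx⟩ hcd.symm)
      exact ⟨c, ⟨hc, hcQ.2⟩, d, ⟨hd, hdC⟩, hcQ.1, fun hh => hdQ ⟨hh, hdC⟩, hcd⟩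
  have hCL' : C ⊆ L := fun p hp => (hCL hp).1
  refine hk4_of h (Set.union_sdiff_cancel hCL') Set.disjoint_sdiff_right hC hrest ?_
  intro z hz
  by_contra hcon
  push Not at hcon
  have hLR : ∀ v, v ∈ L → v ∈ R → False := fun v h1 h2 => Set.disjoint_left.1 h.disj h1 h2
  have hzL : ∀ v ∈ L, v ≠ z := fun v hv e => hLR v hv (e ▸ hz)
  obtain ⟨c, d, hcx, hcz, hdx, hdz, hcQ, hdQ, hcd⟩ := h.pair x hx z hz
    (C ∪ {r | ∃ K ⊆ R \ {z}, Cn G K ∧ r ∈ K ∧ Ad G C K}) y hyx (hzL y hy) (Or.inl hyC)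
    w hwL.2 (hzL w hwL.1) (by
      rintro (hh | ⟨K, hK, -, hwK, -⟩)
      · exact hwC hh
      · exact hLR w hwL.1 (hK hwK).1)
  rcases hcQ with hcC | ⟨K, hK, hKc, hcK, hCK⟩
  · rcases h.cover d with hdL | hdR
    · exact hdQ (Or.inl (hmax c hcC d ⟨hdL, hdx⟩ hcd))
    · exact hdQ (Or.inr ⟨{d}, by simpa using ⟨hdR, hdz⟩, cn_singleton G d, rfl,
        ⟨c, hcC, d, rfl, hcd⟩⟩)
  · rcases h.cover d with hdL | hdR
    · exact hcon K hK hKc hCK ⟨d, ⟨hdL, fun hh => hdQ (Or.inl hh)⟩, c, hcK, hcd.symm⟩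
    · exact hdQ (Or.inr ⟨K ∪ {d}, Set.union_subset hK (by simpa using ⟨hdR, hdz⟩),
        cn_insert hKc hcK hcd, Or.inr rfl, hCK.mono subset_rfl Set.subset_union_left⟩)

lemma Gd.edge {V : Type} {G : SimpleGraph V} {L R : Set V} (h : Gd G L R) {x y : V}
    (hx : x ∈ L) (hy : y ∈ R) : ∃ a ∈ L, ∃ b ∈ R, a ≠ x ∧ b ≠ y ∧ G.Adj a b := by
  obtain ⟨a, ha, hax⟩ := h.twoL x
  obtain ⟨b, hb, hby⟩ := h.twoR y
  have hLR : ∀ v, v ∈ L → v ∈ R → False := fun v h1 h2 => Set.disjoint_left.1 h.disj h1 h2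
  obtain ⟨c, d, hcx, hcy, hdx, hdy, hc, hd, hcd⟩ := h.pair x hx y hy L a hax
    (fun e => hLR a ha (e ▸ hy)) ha b (fun e => hLR b (e ▸ hx) hb) hby (fun hh => hLR b hh hb)
  exact ⟨c, hc, d, (h.cover d).resolve_left hd, hcx, hdy, hcd⟩

/-- Without cutvertices, either we find the special `K₄` or the bond is a matching. -/
lemma matching {V : Type} [Finite V] {G : SimpleGraph V} {L R : Set V} (h : Gd G L R)
    (hno : ¬ HK4 G L R) {x y y' : V} (hx : x ∈ L) (hy : y ∈ R) (hy' : y' ∈ R)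
    (hxy : G.Adj x y) (hxy' : G.Adj x y') : y = y' := by
  by_contra hne
  apply hno
  have hL : Cn G (L \ {x}) := by
    by_contra hh
    exact hno (hk4_of_cut h hx hh)
  refine hk4_of h (A1 := {x}) (A2 := L \ {x}) (Set.union_sdiff_cancel (by simpa using hx))
    Set.disjoint_sdiff_right (cn_singleton G x) hL ?_
  intro z hz
  refine ⟨R \ {z}, subset_rfl, ?_, ?_, ?_⟩
  · by_contra hh
    exact hno (hk4_of_cut h.symm hz hh).symm
  · by_cases hyz : y = z
    · exact ⟨x, rfl, y', ⟨hy', fun e => hne (hyz.trans e.symm)⟩, hxy'⟩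
    · exact ⟨x, rfl, y, ⟨hy, hyz⟩, hxy⟩
  · obtain ⟨a, ha, b, hb, hax, hbz, hab⟩ := h.edge hx hz
    exact ⟨a, ⟨ha, hax⟩, b, ⟨hb, hbz⟩, hab⟩

/-- Rooted triangle minor. -/
lemma triangle {V : Type} [Finite V] {G : SimpleGraph V} {L : Set V}
    (hcut : ∀ x ∈ L, Cn G (L \ {x})) {a b c : V} (ha : a ∈ L) (hb : b ∈ L) (hc : c ∈ L)
    (hab : a ≠ b) (hac : a ≠ c) (hbc : b ≠ c) :
    ∃ B C, B ∪ C = L \ {a} ∧ Disjoint B C ∧ Cn G B ∧ Cn G C ∧ b ∈ B ∧ c ∈ C ∧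
      Ad G {a} B ∧ Ad G {a} C ∧ Ad G B C := by
  obtain ⟨B1, B2, hB, hd, h1, h2, ⟨p, hp1, hp⟩, ⟨q, hq1, hq⟩, ⟨r, hr1, hr⟩, ⟨s, hs1, hs⟩⟩ :=
    menger2' G (L \ {a}) {b, c} {v | G.Adj a v} (hcut a ha) (by
      intro z hz
      have hw : ∃ w, w ∈ L ∧ w ≠ a ∧ w ≠ z ∧ (w = b ∨ w = c) := by
        by_cases hbz : b = z
        · exact ⟨c, hc, hac.symm, fun e => hbc (hbz.trans e.symm), Or.inr rfl⟩
        · exact ⟨b, hb, hab.symm, hbz, Or.inl rfl⟩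
      obtain ⟨w, hwL, hwa, hwz, hw⟩ := hw
      obtain ⟨P, hPK, hP, hwP, m, hm, ham⟩ := exists_attach (hcut z hz.1) (x := a) (y := w)
        ⟨ha, fun e => hz.2 e.symm⟩ ⟨hwL, hwz⟩ hwa
      exact ⟨P, fun v hv => ⟨⟨(hPK hv).1.1, (hPK hv).2⟩, (hPK hv).1.2⟩, hP, ⟨w, hwP, hw⟩,
        ⟨m, hm, ham⟩⟩)
  have hBC : Ad G B1 B2 := by
    obtain ⟨u, hu⟩ := h1.1
    obtain ⟨v, hv⟩ := h2.1
    obtain ⟨c, hc, d, hd', hcB, hdB, hcd⟩ := (hcut a ha).cross B1 (hB ▸ Or.inl hu) hu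
      (hB ▸ Or.inr hv) (fun hh => Set.disjoint_left.1 hd hh hv)
    rw [← hB] at hd'
    exact ⟨c, hcB, d, hd'.resolve_left hdB, hcd⟩
  have hdis : ∀ v, v ∈ B1 → v ∈ B2 → False := fun v h1 h2 => Set.disjoint_left.1 hd h1 h2
  rcases hp with rfl | rfl
  · rcases hr with rfl | rfl
    · exact (hdis _ hp1 hr1).elim
    · exact ⟨B1, B2, hB, hd, h1, h2, hp1, hr1, ⟨a, rfl, q, hq1, hq⟩, ⟨a, rfl, s, hs1, hs⟩, hBC⟩
  · rcases hr with rfl | rfl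
    · exact ⟨B2, B1, Set.union_comm B1 B2 ▸ hB, hd.symm, h2, h1, hr1, hp1,
        ⟨a, rfl, s, hs1, hs⟩, ⟨a, rfl, q, hq1, hq⟩, hBC.symm⟩
    · exact (hdis _ hp1 hr1).elim

/-- The partition data for the special prism. -/
def HPr {V : Type} (G : SimpleGraph V) (L R : Set V) : Prop :=
  ∃ A0 A1 A2 B0 B1 B2 : Set V, (∀ v, v ∈ L ↔ v ∈ A0 ∨ v ∈ A1 ∨ v ∈ A2) ∧
    (∀ v, v ∈ R ↔ v ∈ B0 ∨ v ∈ B1 ∨ v ∈ B2) ∧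
    Disjoint A0 A1 ∧ Disjoint A0 A2 ∧ Disjoint A1 A2 ∧
    Disjoint B0 B1 ∧ Disjoint B0 B2 ∧ Disjoint B1 B2 ∧
    Cn G A0 ∧ Cn G A1 ∧ Cn G A2 ∧ Cn G B0 ∧ Cn G B1 ∧ Cn G B2 ∧
    Ad G A0 A1 ∧ Ad G A0 A2 ∧ Ad G A1 A2 ∧ Ad G B0 B1 ∧ Ad G B0 B2 ∧ Ad G B1 B2 ∧
    Ad G A0 B0 ∧ Ad G A1 B1 ∧ Ad G A2 B2 ∧
    ¬ Ad G A0 B1 ∧ ¬ Ad G A0 B2 ∧ ¬ Ad G A1 B0 ∧ ¬ Ad G A1 B2 ∧ ¬ Ad G A2 B0 ∧ ¬ Ad G A2 B1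

lemma main {V : Type} [Finite V] {G : SimpleGraph V} {L R : Set V} (h : Gd G L R) :
    HK4 G L R ∨ HPr G L R := by
  by_cases hno : HK4 G L R
  · exact Or.inl hno
  have hno' : ¬ HK4 G R L := fun hh => hno hh.symm
  have hcL : ∀ x ∈ L, Cn G (L \ {x}) := fun x hx => by
    by_contra hh
    exact hno (hk4_of_cut h hx hh)
  have hcR : ∀ x ∈ R, Cn G (R \ {x}) := fun x hx => by
    by_contra hh
    exact hno' (hk4_of_cut h.symm hx hh)
  obtain ⟨x, hx⟩ := h.cL.1
  obtain ⟨y, hy⟩ := h.cR.1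
  obtain ⟨x1, hx1, y1, hy1, -, -, e1⟩ := h.edge hx hy
  obtain ⟨x2, hx2, y2, hy2, hx21, hy21, e2⟩ := h.edge hx1 hy1
  obtain ⟨x3, hx3, y3, hy3, hx31, hy32, e3⟩ := h.edge hx1 hy2
  have hx32 : x3 ≠ x2 := by
    rintro rfl
    exact hy32 (matching h hno hx3 hy3 hy2 e3 e2)
  have hy31 : y3 ≠ y1 := by
    rintro rfl
    exact hx31 (matching h.symm hno' hy3 hx3 hx1 e3.symm e1.symm)
  obtain ⟨B, C, hBC, dBC, cB, cC, hxB, hxC, aB, aC, aBC⟩ :=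
    triangle hcL hx1 hx2 hx3 hx21.symm hx31.symm hx32.symm
  obtain ⟨D, E, hDE, dDE, cD, cE, hyD, hyE, aD, aE, aDE⟩ :=
    triangle hcR hy1 hy2 hy3 hy21.symm hy31.symm hy32.symm
  have mB : ∀ v ∈ B, v ∈ L ∧ v ≠ x1 := fun v hv => by
    have : v ∈ L \ {x1} := hBC ▸ Or.inl hv
    exact this
  have mC : ∀ v ∈ C, v ∈ L ∧ v ≠ x1 := fun v hv => by
    have : v ∈ L \ {x1} := hBC ▸ Or.inr hv
    exact this
  have mD : ∀ v ∈ D, v ∈ R ∧ v ≠ y1 := fun v hv => by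
    have : v ∈ R \ {y1} := hDE ▸ Or.inl hv
    exact this
  have mE : ∀ v ∈ E, v ∈ R ∧ v ≠ y1 := fun v hv => by
    have : v ∈ R \ {y1} := hDE ▸ Or.inr hv
    exact this
  have hLm : ∀ v, v ∈ L ↔ v ∈ ({x1} : Set V) ∨ v ∈ B ∨ v ∈ C := by
    intro v
    constructor
    · intro hv
      by_cases hvx : v = x1
      · exact Or.inl hvx
      · have : v ∈ B ∪ C := hBC ▸ ⟨hv, hvx⟩
        exact Or.inr this
    · rintro (hv | hv | hv)
      · rw [Set.mem_singleton_iff] at hv; rw [hv]; exact hx1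
      · exact (mB v hv).1
      · exact (mC v hv).1
  have hRm : ∀ v, v ∈ R ↔ v ∈ ({y1} : Set V) ∨ v ∈ D ∨ v ∈ E := by
    intro v
    constructor
    · intro hv
      by_cases hvx : v = y1
      · exact Or.inl hvx
      · have : v ∈ D ∪ E := hDE ▸ ⟨hv, hvx⟩
        exact Or.inr this
    · rintro (hv | hv | hv)
      · rw [Set.mem_singleton_iff] at hv; rw [hv]; exact hy1
      · exact (mD v hv).1
      · exact (mE v hv).1
  have d1 : Disjoint {x1} B := Set.disjoint_singleton_left.2 fun hh => (mB _ hh).2 rfl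
  have d2 : Disjoint {x1} C := Set.disjoint_singleton_left.2 fun hh => (mC _ hh).2 rfl
  have d3 : Disjoint {y1} D := Set.disjoint_singleton_left.2 fun hh => (mD _ hh).2 rfl
  have d4 : Disjoint {y1} E := Set.disjoint_singleton_left.2 fun hh => (mE _ hh).2 rfl
  have a11 : Ad G {x1} {y1} := ⟨x1, rfl, y1, rfl, e1⟩
  have aBD : Ad G B D := ⟨x2, hxB, y2, hyD, e2⟩
  have aCE : Ad G C E := ⟨x3, hxC, y3, hyE, e3⟩
  have hBE : ¬ Ad G B E := by
    intro hh
    apply hno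
    refine ⟨B, {x1} ∪ C, {y1} ∪ D, E, ?_, ?_, ?_, ?_, cB,
      cn_union_adj (cn_singleton G x1) cC aC, cn_union_adj (cn_singleton G y1) cD aD, cE,
      aBD.mono subset_rfl Set.subset_union_right, hh,
      a11.mono Set.subset_union_left Set.subset_union_left,
      aCE.mono Set.subset_union_right subset_rfl⟩
    · ext v; rw [hLm v]; simp only [Set.mem_union]; tauto
    · rw [Set.disjoint_union_right]; exact ⟨d1.symm, dBC⟩
    · ext v; rw [hRm v]; simp only [Set.mem_union]; tauto
    · rw [Set.disjoint_union_left]; exact ⟨d4, dDE⟩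
  have hCD : ¬ Ad G C D := by
    intro hh
    apply hno
    refine ⟨C, {x1} ∪ B, {y1} ∪ E, D, ?_, ?_, ?_, ?_, cC,
      cn_union_adj (cn_singleton G x1) cB aB, cn_union_adj (cn_singleton G y1) cE aE, cD,
      aCE.mono subset_rfl Set.subset_union_right, hh,
      a11.mono Set.subset_union_left Set.subset_union_left,
      aBD.mono Set.subset_union_right subset_rfl⟩
    · ext v; rw [hLm v]; simp only [Set.mem_union]; tauto
    · rw [Set.disjoint_union_right]; exact ⟨d2.symm, dBC.symm⟩
    · ext v; rw [hRm v]; simp only [Set.mem_union]; tauto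
    · rw [Set.disjoint_union_left]; exact ⟨d3, dDE.symm⟩
  have hxr : ∀ T : Set V, (∀ v ∈ T, v ∈ R ∧ v ≠ y1) → ¬ Ad G {x1} T := by
    rintro T hT ⟨u, hu, v, hv, huv⟩
    rw [Set.mem_singleton_iff] at hu
    subst hu
    exact (hT v hv).2 (matching h hno hx1 (hT v hv).1 hy1 huv e1)
  have hyl : ∀ T : Set V, (∀ v ∈ T, v ∈ L ∧ v ≠ x1) → ¬ Ad G T {y1} := by
    rintro T hT ⟨v, hv, u, hu, huv⟩
    rw [Set.mem_singleton_iff] at hu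
    subst hu
    exact (hT v hv).2 (matching h.symm hno' hy1 (hT v hv).1 hx1 huv.symm e1.symm)
  exact Or.inr ⟨{x1}, B, C, {y1}, D, E, hLm, hRm, d1, d2, dBC, d3, d4, dDE, cn_singleton G x1, cB,
    cC, cn_singleton G y1, cD, cE, aB, aC, aBC, aD, aE, aDE, a11, aBD, aCE, hxr D mD, hxr E mE,
    hyl B mB, hBE, hyl C mC, hCD⟩

lemma contractFun_val {V : Type} {u v : V} (huv : u ≠ v) {W : Type} (f : V → W) (hf : f u = f v)
    (x : V) : f (contractFun huv x).1 = f x := by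
  unfold contractFun
  split_ifs with h
  · rw [h]; exact hf
  · rfl

lemma contractFun_self {V : Type} {u v : V} (huv : u ≠ v) (x : {w : V // w ≠ v}) :
    contractFun huv x.1 = x := by
  unfold contractFun
  rw [dif_neg x.2]

lemma contractGraph_adj {V : Type} {G : SimpleGraph V} {u v : V} (huv : u ≠ v)
    (a b : {w : V // w ≠ v}) : (contractGraph G huv).Adj a b ↔
      a ≠ b ∧ ∃ c d, contractFun huv c = a ∧ contractFun huv d = b ∧ G.Adj c d := by
  unfold contractGraph
  rw [fromEdgeSet_adj]
  constructor
  · rintro ⟨⟨e, he, hab⟩, hne⟩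
    refine ⟨hne, ?_⟩
    induction e with | _ c d =>
    rw [Sym2.map_mk, Sym2.eq_iff] at hab
    rw [mem_edgeSet] at he
    rcases hab with ⟨h1, h2⟩ | ⟨h1, h2⟩
    · exact ⟨c, d, h1, h2, he⟩
    · exact ⟨d, c, h2, h1, he.symm⟩
  · rintro ⟨hne, c, d, rfl, rfl, hcd⟩
    exact ⟨⟨s(c, d), hcd, by simp⟩, hne⟩

/-- Contracting the fibres of `f`. -/
lemma quotient (D : CGraph) : ∀ (n : ℕ) (C : CGraph) (f : C.V → D.V), Nat.card C.V = n →
    Function.Surjective f → (∀ w, Cn C.G (f ⁻¹' {w})) →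
    (∀ a b, D.G.Adj a b ↔ a ≠ b ∧ ∃ u v, f u = a ∧ f v = b ∧ C.G.Adj u v) →
    Sym2.map f '' C.X = D.X → (∀ e ∈ C.X, ¬ (Sym2.map f e).IsDiag) →
    ∃ C', IsSCMinor C C' ∧ CGIso C' D := by
  intro n
  induction n with
  | zero =>
    intro C f hn hsurj hcn hG hX hnd
    refine ⟨C, Relation.ReflTransGen.refl, ?_⟩
    have hemp : IsEmpty C.V := by
      rcases Finite.card_eq_zero_iff.1 hn with h
      exact h
    have hbij : Function.Bijective f := ⟨fun a => hemp.elim a, hsurj⟩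
    exact ⟨⟨Equiv.ofBijective f hbij, fun {a} => hemp.elim a⟩, hX⟩
  | succ n ih =>
    intro C f hn hsurj hcn hG hX hnd
    by_cases hinj : Function.Injective f
    · refine ⟨C, Relation.ReflTransGen.refl, ⟨Equiv.ofBijective f ⟨hinj, hsurj⟩, ?_⟩, hX⟩
      intro a b
      change D.G.Adj (f a) (f b) ↔ C.G.Adj a b
      rw [hG]
      constructor
      · rintro ⟨-, u, v, hu, hv, huv⟩
        rw [← hinj hu, ← hinj hv]; exact huv
      · intro hab
        exact ⟨fun e => hab.ne (hinj e), a, b, rfl, rfl, hab⟩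
    · unfold Function.Injective at hinj
      push Not at hinj
      obtain ⟨a, b, hab, hne⟩ := hinj
      obtain ⟨v, hv, u, hu, -, -, hvu⟩ := (hcn (f b)).cross {a} (a := a) (b := b) hab rfl rfl
        hne.symm
      have huv : C.G.Adj u v := hvu.symm
      have hfuv : f u = f v := by
        simp only [Set.mem_preimage, Set.mem_singleton_iff] at hu hv
        rw [hu, hv]
      have hd : s(u, v) ∉ C.X := fun h => hnd _ h (by simpa using hfuv)
      have hval := contractFun_val huv.ne f hfuv
      have hcomp : (fun w : {w : C.V // w ≠ v} => f w.1) ∘ contractFun huv.ne = f :=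
        funext hval
      obtain ⟨C', hC', hiso⟩ := ih (C.contract u v huv.ne) (fun w => f w.1) (by
          change Nat.card {w : C.V // w ≠ v} = n
          have := Set.ncard_sdiff_singleton_of_mem (Set.mem_univ v)
          rw [Set.ncard_univ, hn, ← Nat.card_coe_set_eq] at this
          rw [Nat.add_sub_cancel] at this
          rw [← this]
          exact Nat.card_congr (Equiv.subtypeEquivRight (fun w => by simp))) (by
          intro w
          obtain ⟨x, hx⟩ := hsurj w
          exact ⟨contractFun huv.ne x, (hval x).trans hx⟩) (by
          intro w
          change Cn (contractGraph C.G huv.ne) ((fun w : {w : C.V // w ≠ v} => f w.1) ⁻¹' {w})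
          refine cn_of_cross ?_ ?_
          · obtain ⟨x, hx⟩ := (hcn w).1
            exact ⟨contractFun huv.ne x, (hval x).trans hx⟩
          · intro Q a ha haQ b hb hbQ
            obtain ⟨c, hc, d, hd, hcQ, hdQ, hcd⟩ := (hcn w).cross (contractFun huv.ne ⁻¹' Q)
              (a := a.1) (b := b.1) ha (by
                rw [Set.mem_preimage, contractFun_self]; exact haQ) hb (by
                rw [Set.mem_preimage, contractFun_self]; exact hbQ)
            refine ⟨contractFun huv.ne c, (hval c).trans hc, contractFun huv.ne d,
              (hval d).trans hd, hcQ, hdQ, ?_⟩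
            refine (contractGraph_adj huv.ne _ _).2 ⟨fun e => hdQ ?_, c, d, rfl, rfl, hcd⟩
            rw [Set.mem_preimage, ← e]; exact hcQ) (by
          intro a b
          rw [hG]
          refine and_congr_right fun hne => ⟨?_, ?_⟩
          · rintro ⟨c, d, hc, hd, hcd⟩
            refine ⟨contractFun huv.ne c, contractFun huv.ne d, (hval c).trans hc,
              (hval d).trans hd, ?_⟩
            refine (contractGraph_adj huv.ne _ _).2 ⟨fun e => hne ?_, c, d, rfl, rfl, hcd⟩
            rw [← hc, ← hd, ← hval c, ← hval d, e]
          · rintro ⟨p, q, hp, hq, hpq⟩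
            obtain ⟨-, c, d, hc, hd, hcd⟩ := (contractGraph_adj huv.ne _ _).1 hpq
            refine ⟨c, d, ?_, ?_, hcd⟩
            · rw [← hval c, hc]; exact hp
            · rw [← hval d, hd]; exact hq) (by
          rw [← hX]
          ext e
          constructor
          · rintro ⟨e1, ⟨⟨e0, he0, rfl⟩, -⟩, rfl⟩
            have hm : Sym2.map (fun w : {w : C.V // w ≠ v} => f w.1)
                (Sym2.map (contractFun huv.ne) e0) = Sym2.map f e0 := by
              rw [Sym2.map_map]; exact congrArg (fun g => Sym2.map g e0) hcomp
            exact ⟨e0, he0, hm.symm⟩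
          · rintro ⟨e0, he0, rfl⟩
            have hm : Sym2.map (fun w : {w : C.V // w ≠ v} => f w.1)
                (Sym2.map (contractFun huv.ne) e0) = Sym2.map f e0 := by
              rw [Sym2.map_map]; exact congrArg (fun g => Sym2.map g e0) hcomp
            refine ⟨Sym2.map (contractFun huv.ne) e0, ⟨⟨e0, he0, rfl⟩, fun hdg => ?_⟩, hm⟩
            apply hnd e0 he0
            rw [← hm]
            exact hdg.map) (by
          rintro e1 ⟨⟨e0, he0, rfl⟩, -⟩
          have hm : Sym2.map (fun w : {w : C.V // w ≠ v} => f w.1)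
                (Sym2.map (contractFun huv.ne) e0) = Sym2.map f e0 := by
              rw [Sym2.map_map]; exact congrArg (fun g => Sym2.map g e0) hcomp
          intro hdg
          apply hnd e0 he0
          rw [← hm]
          exact hdg)
      exact ⟨C', Relation.ReflTransGen.head (SCMStep.contr C u v huv hd) hC', hiso⟩

/-- Contracting a partition given by parts; `l` tells which parts are on the left side. -/
lemma of_parts (C : CGraph) (S : Set C.V) (hX : C.X = crossEdges C.G S) (D : CGraph)
    (p : D.V → Set C.V) (l : Set D.V) (hcov : ∀ v, ∃ i, v ∈ p i)
    (hdis : ∀ i j v, v ∈ p i → v ∈ p j → i = j) (hcn : ∀ i, Cn C.G (p i))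
    (hl : ∀ i v, v ∈ p i → (v ∈ S ↔ i ∈ l))
    (hG : ∀ i j, i ≠ j → (D.G.Adj i j ↔ Ad C.G (p i) (p j)))
    (hDX : D.X = crossEdges D.G l) : ∃ C', IsSCMinor C C' ∧ CGIso C' D := by
  choose f hf using hcov
  have hfi : ∀ v i, f v = i ↔ v ∈ p i := fun v i =>
    ⟨fun h => h ▸ hf v, fun h => hdis _ _ v (hf v) h⟩
  have hfib : ∀ i, f ⁻¹' {i} = p i := fun i => by
    ext v; simp [hfi]
  have hfS : ∀ v, v ∈ S ↔ f v ∈ l := fun v => hl _ v (hf v)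
  have hadj : ∀ a b, D.G.Adj a b ↔ a ≠ b ∧ ∃ u v, f u = a ∧ f v = b ∧ C.G.Adj u v := by
    intro a b
    constructor
    · intro h
      obtain ⟨u, hu, v, hv, huv⟩ := (hG a b h.ne).1 h
      exact ⟨h.ne, u, v, (hfi u a).2 hu, (hfi v b).2 hv, huv⟩
    · rintro ⟨hne, u, v, hu, hv, huv⟩
      exact (hG a b hne).2 ⟨u, (hfi u a).1 hu, v, (hfi v b).1 hv, huv⟩
  have hce : ∀ {V : Type} (Q : SimpleGraph V) (T : Set V) (e : Sym2 V), e ∈ crossEdges Q T ↔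
      ∃ u v, e = s(u, v) ∧ Q.Adj u v ∧ u ∈ T ∧ v ∉ T := by
    intro V Q T e
    induction e with | _ a b =>
    constructor
    · rintro ⟨he, ⟨x, hx, hxT⟩, ⟨y, hy, hyT⟩⟩
      rw [mem_edgeSet] at he
      rw [Sym2.mem_iff] at hx hy
      rcases hx with rfl | rfl <;> rcases hy with rfl | rfl
      · exact absurd hxT hyT
      · exact ⟨_, _, rfl, he, hxT, hyT⟩
      · exact ⟨_, _, Sym2.eq_swap, he.symm, hxT, hyT⟩
      · exact absurd hxT hyT
    · rintro ⟨u, v, he, huv, hu, hv⟩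
      rw [he]
      exact ⟨huv, ⟨u, by simp, hu⟩, ⟨v, by simp, hv⟩⟩
  refine quotient D _ C f rfl ?_ ?_ hadj ?_ ?_
  · intro i
    obtain ⟨v, hv⟩ := (hcn i).1
    exact ⟨v, (hfi v i).2 hv⟩
  · intro i
    rw [hfib]; exact hcn i
  · rw [hX, hDX]
    ext e
    rw [hce]
    constructor
    · rintro ⟨e0, he0, rfl⟩
      obtain ⟨u, v, rfl, huv, hu, hv⟩ := (hce _ _ _).1 he0
      have h1 := (hfS u).1 hu
      have h2 : f v ∉ l := fun h => hv ((hfS v).2 h)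
      exact ⟨f u, f v, by simp, (hadj _ _).2 ⟨fun h => h2 (h ▸ h1), u, v, rfl, rfl, huv⟩, h1, h2⟩
    · rintro ⟨a, b, rfl, hab, ha, hb⟩
      obtain ⟨-, u, v, rfl, rfl, huv⟩ := (hadj _ _).1 hab
      exact ⟨s(u, v), (hce _ _ _).2 ⟨u, v, rfl, huv, (hfS u).2 ha, fun h => hb ((hfS v).1 h)⟩,
        by simp⟩
  · rw [hX]
    intro e he hd
    obtain ⟨u, v, rfl, huv, hu, hv⟩ := (hce _ _ _).1 he
    rw [Sym2.map_mk, Sym2.mk_isDiag_iff] at hd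
    exact hv ((hfS v).2 (hd ▸ (hfS u).1 hu))

lemma of_parts' (C : CGraph) (S : Set C.V) (hX : C.X = crossEdges C.G S) {n : ℕ}
    (DG : SimpleGraph (Fin n)) (DX : Set (Sym2 (Fin n)))
    (p : Fin n → Set C.V) (l : Set (Fin n)) (hcov : ∀ v, ∃ i, v ∈ p i)
    (hdis : ∀ i j v, v ∈ p i → v ∈ p j → i = j) (hcn : ∀ i, Cn C.G (p i))
    (hl : ∀ i v, v ∈ p i → (v ∈ S ↔ i ∈ l))
    (hG : ∀ i j, i ≠ j → (DG.Adj i j ↔ Ad C.G (p i) (p j)))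
    (hDX : DX = crossEdges DG l) :
    ∃ C', IsSCMinor C C' ∧ CGIso C' ⟨Fin n, DG, DX, inferInstance⟩ :=
  of_parts C S hX ⟨Fin n, DG, DX, inferInstance⟩ p l hcov hdis hcn hl hG hDX

lemma k4_bond : specialK4.X = crossEdges specialK4.G ({0, 1} : Set (Fin 4)) := by
  change ({s(0, 2), s(0, 3), s(1, 2), s(1, 3)} : Set (Sym2 (Fin 4))) =
    crossEdges (⊤ : SimpleGraph (Fin 4)) ({0, 1} : Set (Fin 4))
  ext e
  induction e with | _ a b =>
  simp only [crossEdges, Set.mem_ofPred_eq, mem_edgeSet, top_adj, Sym2.mem_iff,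
    Set.mem_insert_iff, Set.mem_singleton_iff]
  revert a b
  decide

lemma prism_bond : specialPrism.X = crossEdges specialPrism.G ({0, 1, 2} : Set (Fin 6)) := by
  change ({s(0, 3), s(1, 4), s(2, 5)} : Set (Sym2 (Fin 6))) =
    crossEdges prismGraph ({0, 1, 2} : Set (Fin 6))
  ext e
  induction e with | _ a b =>
  simp only [crossEdges, prismGraph, Set.mem_ofPred_eq, mem_edgeSet, fromEdgeSet_adj, Sym2.mem_iff,
    Set.mem_insert_iff, Set.mem_singleton_iff]
  revert a b
  decide

lemma ad_of_partition {V : Type} {G : SimpleGraph V} {A B W : Set V} (hW : Cn G W)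
    (h : A ∪ B = W) (hd : Disjoint A B) (hA : Cn G A) (hB : Cn G B) : Ad G A B := by
  obtain ⟨a, ha⟩ := hA.1
  obtain ⟨b, hb⟩ := hB.1
  obtain ⟨c, hc, d, hd', hcA, hdA, hcd⟩ := hW.cross A (h ▸ Or.inl ha) ha (h ▸ Or.inr hb)
    (fun hh => Set.disjoint_left.1 hd hh hb)
  rw [← h] at hd'
  exact ⟨c, hcA, d, hd'.resolve_left hdA, hcd⟩

lemma k4_final (C : CGraph) (S : Set C.V) (hX : C.X = crossEdges C.G S) (h : Gd C.G S Sᶜ)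
    (hk : HK4 C.G S Sᶜ) : ∃ C', IsSCMinor C C' ∧ CGIso C' specialK4 := by
  obtain ⟨A1, A2, B1, B2, hA, dA, hB, dB, cA1, cA2, cB1, cB2, a11, a12, a21, a22⟩ := hk
  have aA := ad_of_partition h.cL hA dA cA1 cA2
  have aB := ad_of_partition h.cR hB dB cB1 cB2
  have mA1 : ∀ v ∈ A1, v ∈ S := fun v hv => hA ▸ Or.inl hv
  have mA2 : ∀ v ∈ A2, v ∈ S := fun v hv => hA ▸ Or.inr hv
  have mB1 : ∀ v ∈ B1, v ∉ S := fun v hv => by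
    have : v ∈ Sᶜ := hB ▸ Or.inl hv
    exact this
  have mB2 : ∀ v ∈ B2, v ∉ S := fun v hv => by
    have : v ∈ Sᶜ := hB ▸ Or.inr hv
    exact this
  rw [Set.disjoint_left] at dA dB
  refine of_parts' C S hX (⊤ : SimpleGraph (Fin 4)) specialK4.X (![A1, A2, B1, B2] : Fin 4 → Set C.V) ({0, 1} : Set (Fin 4))
    ?_ ?_ ?_ ?_ ?_ k4_bond
  · intro v
    by_cases hv : v ∈ S
    · rw [← hA] at hv
      rcases hv with hv | hv
      · exact ⟨(0 : Fin 4), hv⟩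
      · exact ⟨(1 : Fin 4), hv⟩
    · have hv : v ∈ B1 ∪ B2 := hB ▸ hv
      rcases hv with hv | hv
      · exact ⟨(2 : Fin 4), hv⟩
      · exact ⟨(3 : Fin 4), hv⟩
  · intro (i : Fin 4) (j : Fin 4) v
    fin_cases i <;> fin_cases j <;> simp <;> grind
  · intro (i : Fin 4)
    fin_cases i <;> assumption
  · intro (i : Fin 4) v
    fin_cases i <;> simp <;> grind
  · intro (i : Fin 4) (j : Fin 4) hij
    have e : (⊤ : SimpleGraph (Fin 4)).Adj i j := hij
    refine ⟨fun _ => ?_, fun _ => e⟩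
    clear e
    fin_cases i <;> fin_cases j <;>
      first | exact absurd rfl hij | assumption | (apply Ad.symm; assumption)

lemma six_disj {α : Type*} {A0 A1 A2 B0 B1 B2 : Set α} {v : α} {s : Prop}
    (e1 : v ∈ A0 → v ∉ A1) (e2 : v ∈ A0 → v ∉ A2) (e3 : v ∈ A1 → v ∉ A2)
    (e4 : v ∈ B0 → v ∉ B1) (e5 : v ∈ B0 → v ∉ B2) (e6 : v ∈ B1 → v ∉ B2)
    (h1 : s ↔ v ∈ A0 ∨ v ∈ A1 ∨ v ∈ A2) (h2 : ¬ s ↔ v ∈ B0 ∨ v ∈ B1 ∨ v ∈ B2)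
    (i j : Fin 6) (hi : v ∈ (![A0, A1, A2, B0, B1, B2] : Fin 6 → Set α) i)
    (hj : v ∈ (![A0, A1, A2, B0, B1, B2] : Fin 6 → Set α) j) : i = j := by
  have key : ∃ k : Fin 6, ∀ i : Fin 6,
      v ∈ (![A0, A1, A2, B0, B1, B2] : Fin 6 → Set α) i → i = k := by
    simp only [Fin.forall_fin_succ, IsEmpty.forall_iff, and_true]
    change ∃ k : Fin 6, (v ∈ A0 → (0 : Fin 6) = k) ∧ (v ∈ A1 → (1 : Fin 6) = k) ∧
      (v ∈ A2 → (2 : Fin 6) = k) ∧ (v ∈ B0 → (3 : Fin 6) = k) ∧ (v ∈ B1 → (4 : Fin 6) = k) ∧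
      (v ∈ B2 → (5 : Fin 6) = k)
    clear hi hj i j
    by_cases hs : s
    · rcases h1.1 hs with h | h | h
      · exact ⟨0, by grind⟩
      · exact ⟨1, by grind⟩
      · exact ⟨2, by grind⟩
    · rcases h2.1 hs with h | h | h
      · exact ⟨3, by grind⟩
      · exact ⟨4, by grind⟩
      · exact ⟨5, by grind⟩
  obtain ⟨k, hk⟩ := key
  rw [hk i hi, hk j hj]

set_option maxHeartbeats 1000000 in
lemma prism_final (C : CGraph) (S : Set C.V) (hX : C.X = crossEdges C.G S)
    (hk : HPr C.G S Sᶜ) : ∃ C', IsSCMinor C C' ∧ CGIso C' specialPrism := by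
  obtain ⟨A0, A1, A2, B0, B1, B2, hA, hB, d1, d2, d3, d4, d5, d6, c1, c2, c3, c4, c5, c6,
    a1, a2, a3, a4, a5, a6, a7, a8, a9, n1, n2, n3, n4, n5, n6⟩ := hk
  rw [Set.disjoint_left] at d1 d2 d3 d4 d5 d6
  have hB' : ∀ v, v ∉ S ↔ v ∈ B0 ∨ v ∈ B1 ∨ v ∈ B2 := hB
  refine of_parts' C S hX prismGraph specialPrism.X (![A0, A1, A2, B0, B1, B2] : Fin 6 → Set C.V)
    ({0, 1, 2} : Set (Fin 6)) ?_ ?_ ?_ ?_ ?_ prism_bond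
  · intro v
    by_cases hv : v ∈ S
    · rcases (hA v).1 hv with hv | hv | hv
      · exact ⟨(0 : Fin 6), hv⟩
      · exact ⟨(1 : Fin 6), hv⟩
      · exact ⟨(2 : Fin 6), hv⟩
    · rcases (hB' v).1 hv with hv | hv | hv
      · exact ⟨(3 : Fin 6), hv⟩
      · exact ⟨(4 : Fin 6), hv⟩
      · exact ⟨(5 : Fin 6), hv⟩
  · intro (i : Fin 6) (j : Fin 6) v hi hj
    have h1 := hA v
    have h2 := hB' v
    exact six_disj (@d1 v) (@d2 v) (@d3 v) (@d4 v) (@d5 v) (@d6 v) h1 h2 i j hi hj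
  · intro (i : Fin 6)
    fin_cases i <;> assumption
  · intro (i : Fin 6) v hi
    have h1 := hA v
    have h2 := hB' v
    clear d1 d2 d3 d4 d5 d6 hA hB hB' a1 a2 a3 a4 a5 a6 a7 a8 a9 n1 n2 n3 n4 n5 n6
    fin_cases i <;> simp at hi ⊢ <;> tauto
  · intro (i : Fin 6) (j : Fin 6) hij
    unfold prismGraph
    rw [fromEdgeSet_adj]
    simp only [Set.mem_insert_iff, Set.mem_singleton_iff]
    fin_cases i <;> fin_cases j <;>
      first
      | exact absurd rfl hij
      | exact iff_of_true (by decide) (by assumption)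
      | exact iff_of_true (by decide) (by apply Ad.symm; assumption)
      | exact iff_of_false (by decide) (by assumption)
      | exact iff_of_false (by decide) (fun hh => by
          have hh' := hh.symm
          contradiction)

end SMC

/-- **Lemma (minor_char_H).** If `Q` is 3-connected along a bond `d` whose two sides both
contain edges, then `(Q, d)` has a special contraction minor that is the special `K₄` or the
special prism. -/
theorem special_minor_char (C : CGraph) (S : Set C.V) (h : ThreeConnAlong C.G C.X S)
    (hL : (sideEdges C.G S).Nonempty) (hR : (sideEdges C.G Sᶜ).Nonempty) :
    ∃ C', IsSCMinor C C' ∧ (CGIso C' specialK4 ∨ CGIso C' specialPrism) := by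
  obtain ⟨⟨hS, hSc, cS, cSc, hX⟩, -, hpair⟩ := h
  have two : ∀ T : Set C.V, (sideEdges C.G T).Nonempty → ∀ x, ∃ a ∈ T, a ≠ x := by
    rintro T ⟨e, he, heT⟩ x
    induction e with | _ a b =>
    rw [mem_edgeSet] at he
    by_cases hax : a = x
    · exact ⟨b, heT b (by simp), fun hb => he.ne (hax.trans hb.symm)⟩
    · exact ⟨a, heT a (by simp), hax⟩
  have hgd : SMC.Gd C.G S Sᶜ :=
    { disj := disjoint_compl_right
      cover := fun v => Classical.em _
      cL := ⟨hS, SMC.cn_of_preconnected cS.preconnected⟩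
      cR := ⟨hSc, SMC.cn_of_preconnected cSc.preconnected⟩
      twoL := two S hL
      twoR := two Sᶜ hR
      pair := by
        intro x hx y hy Q a hax hay haQ b hbx hby hbQ
        obtain ⟨c, hc, d, hd, hcd⟩ := SMC.cn_of_preconnected (hpair x hx y hy)
          ({x, y}ᶜ ∩ Q) Set.inter_subset_left ⟨a, by simp [hax, hay], haQ⟩
          ⟨b, by simp [hbx, hby], fun hh => hbQ hh.2⟩
        have hdQ : d ∉ Q := fun hh => hd.2 ⟨hd.1, hh⟩
        have h1 := hc.1
        have h2 := hd.1
        simp only [Set.mem_compl_iff, Set.mem_insert_iff, Set.mem_singleton_iff, not_or] at h1 h2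
        exact ⟨c, d, h1.1, h1.2, h2.1, h2.2, hc.2, hdQ, hcd⟩ }
  rcases SMC.main hgd with hk | hk
  · obtain ⟨C', h1, h2⟩ := SMC.k4_final C S hX hgd hk
    exact ⟨C', h1, Or.inl h2⟩
  · obtain ⟨C', h1, h2⟩ := SMC.prism_final C S hX hk
    exact ⟨C', h1, Or.inr h2⟩
end
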